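/- arXiv:q-alg/9708018 — 8 statements merged into one kernel-verified Lean document; each statement's English description precedes it below -/
import Mathlib

section
/- Let v1, v2, v3 ∈ ℂ with v1 + v2 + v3 = 0 and let c ∈ ℂ, c ≠ 0. Let q, p : ℂ → ℂ be holomorphic functions satisfying the Hamiltonian form of the fourth Painlevé equation: q'(t) = q(t)(2p(t) − q(t) − 2t) − 2(v1 − v2) and p'(t) = p(t)(2q(t) − p(t) + 2t) + 2(v2 − v3). Define f0(x) = c(q(−cx) − p(−cx) − 2cx), f1(x) = −c·q(−cx), f2(x) = c·p(−cx). Then for all x ∈ ℂ: f0'(x) = f0(x)(f2(x) − f1(x)) − 2c²(1 − v1 + v3), f1'(x) = f1(x)(f0(x) − f2(x)) − 2c²(v1 − v2), f2'(x) = f2(x)(f1(x) − f0(x)) − 2c²(v2 − v3), and f0(x) + f1(x) + f2(x) = −2c²x. In particular, when c² = −3/2 the triple (f0, f1, f2) satisfies the symmetric form of the fourth Painlevé equation with its normalization and parameters α0 = 3(1 − v1 + v3), α1 = 3(v1 − v2), α2 = 3(v2 − v3). -/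
/-- **From the Hamiltonian form to the symmetric form of Painlevé IV.**
Let `v₁ + v₂ + v₃ = 0`, `c ≠ 0`, and let `q, p : ℂ → ℂ` be holomorphic solutions of
`q' = q(2p − q − 2t) − 2(v₁ − v₂)`, `p' = p(2q − p + 2t) + 2(v₂ − v₃)`.
With `f₀(x) = c(q(−cx) − p(−cx) − 2cx)`, `f₁(x) = −c q(−cx)`, `f₂(x) = c p(−cx)`,
the stated first-order system and the normalization `f₀ + f₁ + f₂ = −2c²x` hold;
and when `c² = −3/2` the triple solves the symmetric form of Painlevé IV with
parameters `α₀ = 3(1 − v₁ + v₃)`, `α₁ = 3(v₁ − v₂)`, `α₂ = 3(v₂ − v₃)`. -/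
theorem hamiltonian_to_symmetric_P4
    (v1 v2 v3 : ℂ) (hv : v1 + v2 + v3 = 0) (c : ℂ) (hc : c ≠ 0)
    (q p : ℂ → ℂ) (hq : Differentiable ℂ q) (hp : Differentiable ℂ p)
    (heq_q : ∀ t : ℂ, deriv q t = q t * (2 * p t - q t - 2 * t) - 2 * (v1 - v2))
    (heq_p : ∀ t : ℂ, deriv p t = p t * (2 * q t - p t + 2 * t) + 2 * (v2 - v3))
    (f0 f1 f2 : ℂ → ℂ)
    (hf0 : f0 = fun x : ℂ => c * (q (-c * x) - p (-c * x) - 2 * c * x))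
    (hf1 : f1 = fun x : ℂ => -c * q (-c * x))
    (hf2 : f2 = fun x : ℂ => c * p (-c * x)) :
    (∀ x : ℂ, deriv f0 x = f0 x * (f2 x - f1 x) - 2 * c ^ 2 * (1 - v1 + v3)) ∧
    (∀ x : ℂ, deriv f1 x = f1 x * (f0 x - f2 x) - 2 * c ^ 2 * (v1 - v2)) ∧
    (∀ x : ℂ, deriv f2 x = f2 x * (f1 x - f0 x) - 2 * c ^ 2 * (v2 - v3)) ∧
    (∀ x : ℂ, f0 x + f1 x + f2 x = -2 * c ^ 2 * x) ∧
    (c ^ 2 = -(3 / 2) →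
      (∀ x : ℂ, deriv f0 x + f0 x * (f1 x - f2 x) = 3 * (1 - v1 + v3)) ∧
      (∀ x : ℂ, deriv f1 x + f1 x * (f2 x - f0 x) = 3 * (v1 - v2)) ∧
      (∀ x : ℂ, deriv f2 x + f2 x * (f0 x - f1 x) = 3 * (v2 - v3)) ∧
      (∀ x : ℂ, f0 x + f1 x + f2 x = 3 * x)) := by
  have hlin : ∀ x : ℂ, HasDerivAt (fun x : ℂ => -c * x) (-c) x := fun x => by
    simpa using (hasDerivAt_id x).const_mul (-c)
  have hq' : ∀ x : ℂ, HasDerivAt (fun x : ℂ => q (-c * x)) (deriv q (-c * x) * -c) x :=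
    fun x => (hq (-c * x)).hasDerivAt.comp x (hlin x)
  have hp' : ∀ x : ℂ, HasDerivAt (fun x : ℂ => p (-c * x)) (deriv p (-c * x) * -c) x :=
    fun x => (hp (-c * x)).hasDerivAt.comp x (hlin x)
  have h1 : ∀ x : ℂ, deriv f1 x = f1 x * (f0 x - f2 x) - 2 * c ^ 2 * (v1 - v2) := fun x => by
    rw [hf1, ((hq' x).const_mul (-c)).deriv, heq_q, hf0, hf2]
    ring
  have h2 : ∀ x : ℂ, deriv f2 x = f2 x * (f1 x - f0 x) - 2 * c ^ 2 * (v2 - v3) := fun x => by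
    rw [hf2, ((hp' x).const_mul c).deriv, heq_p, hf0, hf1]
    ring
  have h0 : ∀ x : ℂ, deriv f0 x = f0 x * (f2 x - f1 x) - 2 * c ^ 2 * (1 - v1 + v3) := fun x => by
    have hid : HasDerivAt (fun x : ℂ => 2 * c * x) (2 * c) x := by
      simpa using (hasDerivAt_id x).const_mul (2 * c)
    have hd : HasDerivAt (fun x : ℂ => c * (q (-c * x) - p (-c * x) - 2 * c * x))
        (c * (deriv q (-c * x) * -c - deriv p (-c * x) * -c - 2 * c)) x :=
      (((hq' x).sub (hp' x)).sub hid).const_mul c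
    rw [hf0, hd.deriv, heq_q, heq_p, hf1, hf2]
    ring
  have hsum : ∀ x : ℂ, f0 x + f1 x + f2 x = -2 * c ^ 2 * x := fun x => by
    rw [hf0, hf1, hf2]
    ring
  refine ⟨h0, h1, h2, hsum, fun hc2 => ⟨fun x => ?_, fun x => ?_, fun x => ?_, fun x => ?_⟩⟩
  · linear_combination h0 x - 2 * (1 - v1 + v3) * hc2
  · linear_combination h1 x - 2 * (v1 - v2) * hc2
  · linear_combination h2 x - 2 * (v2 - v3) * hc2
  · linear_combination hsum x - 2 * x * hc2
end

section
/- Let α0, α1, α2 ∈ ℂ with α0 + α1 + α2 = 3, let (f0, f1, f2) be a differentiable solution on ℝ of the symmetric form of the fourth Painlevé equation with its normalization, let i ∈ {0, 1, 2}, and suppose f_i(x) ≠ 0 for all x. Define (indices modulo 3) g_i = f_i, g_{i+1} = f_{i+1} − α_i/f_i, g_{i+2} = f_{i+2} + α_i/f_i, and β_i = −α_i, β_{i+1} = α_{i+1} + α_i, β_{i+2} = α_{i+2} + α_i. Then β0 + β1 + β2 = 3 and (g0, g1, g2) is a differentiable solution of the symmetric form of the fourth Painlevé equation with its normalization and parameters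 (β0, β1, β2) (the Bäcklund transformation s_i maps solutions to solutions). -/
/-- The derivative of `f + c / u` when `u` does not vanish. -/
theorem deriv_add_const_div {f u : ℝ → ℂ} {x : ℝ} (c : ℂ) (hf : DifferentiableAt ℝ f x)
    (hu : DifferentiableAt ℝ u x) (hx : u x ≠ 0) :
    deriv (fun y => f y + c / u y) x = deriv f x - c * deriv u x / u x ^ 2 := by
  have h := hf.hasDerivAt.add ((hasDerivAt_const x c).div hu.hasDerivAt hx)
  refine h.deriv.trans ?_
  ring

/-- The derivative of `f - c / u` when `u` does not vanish. -/
theorem deriv_sub_const_div {f u : ℝ → ℂ} {x : ℝ} (c : ℂ) (hf : DifferentiableAt ℝ f x)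
    (hu : DifferentiableAt ℝ u x) (hx : u x ≠ 0) :
    deriv (fun y => f y - c / u y) x = deriv f x + c * deriv u x / u x ^ 2 := by
  have h := hf.hasDerivAt.sub ((hasDerivAt_const x c).div hu.hasDerivAt hx)
  refine h.deriv.trans ?_
  ring

/-- The Bäcklund transformation at `u` maps a solution `(u, v, w)` of the differential equations
with parameters `(a, b, c)` to one with parameters `(-a, b + a, c + a)`. -/
theorem painleveIV_backlund {u v w : ℝ → ℂ} {a b c : ℂ} {x : ℝ}
    (hu : DifferentiableAt ℝ u x) (hv : DifferentiableAt ℝ v x) (hw : DifferentiableAt ℝ w x)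
    (hx : u x ≠ 0)
    (ha : deriv u x + u x * (v x - w x) = a)
    (hb : deriv v x + v x * (w x - u x) = b)
    (hc : deriv w x + w x * (u x - v x) = c) :
    deriv u x + u x * ((v x - a / u x) - (w x + a / u x)) = -a ∧
    deriv (fun y => v y - a / u y) x
      + (v x - a / u x) * ((w x + a / u x) - u x) = b + a ∧
    deriv (fun y => w y + a / u y) x
      + (w x + a / u x) * (u x - (v x - a / u x)) = c + a := by
  rw [deriv_sub_const_div a hv hu hx, deriv_add_const_div a hw hu hx,
    eq_sub_of_add_eq ha, eq_sub_of_add_eq hb, eq_sub_of_add_eq hc]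
  refine ⟨?_, ?_, ?_⟩ <;> field_simp <;> ring

/-- **The Bäcklund transformation `sᵢ` maps solutions of the symmetric Painlevé IV
system to solutions.**  If `(f₀, f₁, f₂)` is a differentiable solution of
`fⱼ' + fⱼ(fⱼ₊₁ − fⱼ₊₂) = αⱼ` (indices mod 3) with `α₀ + α₁ + α₂ = 3` and
`f₀ + f₁ + f₂ = 3x`, and `fᵢ` never vanishes, then setting
`gᵢ = fᵢ`, `gᵢ₊₁ = fᵢ₊₁ − αᵢ/fᵢ`, `gᵢ₊₂ = fᵢ₊₂ + αᵢ/fᵢ` and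
`βᵢ = −αᵢ`, `βᵢ₊₁ = αᵢ₊₁ + αᵢ`, `βᵢ₊₂ = αᵢ₊₂ + αᵢ`, one has `β₀ + β₁ + β₂ = 3`
and `(g₀, g₁, g₂)` is a differentiable solution of the same system with
parameters `(β₀, β₁, β₂)`. -/
theorem backlund_si_maps_solutions_to_solutions
    (α : Fin 3 → ℂ) (hα : α 0 + α 1 + α 2 = 3)
    (f : Fin 3 → ℝ → ℂ) (hf : ∀ j, Differentiable ℝ (f j))
    (heq : ∀ (j : Fin 3) (x : ℝ),
      deriv (f j) x + f j x * (f (j + 1) x - f (j + 2) x) = α j)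
    (hnorm : ∀ x : ℝ, f 0 x + f 1 x + f 2 x = 3 * x)
    (i : Fin 3) (hne : ∀ x : ℝ, f i x ≠ 0)
    (g : Fin 3 → ℝ → ℂ) (β : Fin 3 → ℂ)
    (hg : g = fun j x => if j = i then f i x
      else if j = i + 1 then f (i + 1) x - α i / f i x
      else f (i + 2) x + α i / f i x)
    (hβ : β = fun j => if j = i then -α i
      else if j = i + 1 then α (i + 1) + α i
      else α (i + 2) + α i) :
    β 0 + β 1 + β 2 = 3 ∧
    (∀ j, Differentiable ℝ (g j)) ∧
    (∀ (j : Fin 3) (x : ℝ),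
      deriv (g j) x + g j x * (g (j + 1) x - g (j + 2) x) = β j) ∧
    (∀ x : ℝ, g 0 x + g 1 x + g 2 x = 3 * x) := by
  have hdiv : Differentiable ℝ fun x => α i / f i x :=
    (differentiable_const _).div (hf i) hne
  have hsys := fun x => painleveIV_backlund (b := α (i + 1)) (c := α (i + 2)) (hf i x) (hf (i + 1) x)
    (hf (i + 2) x) (hne x) (heq i x)
    (by have h := heq (i + 1) x; fin_cases i <;> exact h)
    (by have h := heq (i + 2) x; fin_cases i <;> exact h)
  subst hg hβ
  refine ⟨?_, fun j => ?_, fun j x => ?_, fun x => ?_⟩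
  · fin_cases i <;> simp <;> linear_combination hα
  · dsimp only
    split_ifs
    · exact hf i
    · exact (hf (i + 1)).sub hdiv
    · exact (hf (i + 2)).add hdiv
  · obtain ⟨h₀, h₁, h₂⟩ := hsys x
    fin_cases i <;> fin_cases j <;> first | exact h₀ | exact h₁ | exact h₂
  · have h := hnorm x
    fin_cases i <;> simp <;> linear_combination h
end

section
/- Let α0, α1, α2 ∈ ℂ with α0 + α1 + α2 = 3, and let τ0, τ1, τ2 : ℝ → ℂ be twice differentiable, nowhere-vanishing functions. Define f_i(x) = τ_{i+1}'(x)/τ_{i+1}(x) − τ_{i+2}'(x)/τ_{i+2}(x) + x (indices modulo 3) and g(x) = τ0'(x)/τ0(x) + τ1'(x)/τ1(x) + τ2'(x)/τ2(x). Then the following are equivalent: (a) the three Hirota bilinear equations (D_x² − x·D_x − (α_i − α_{i+1})/3) τ_i·τ_{i+1} = 0 hold for i = 0, 1, 2 (indices mod 3); (b) the triple (f0, f1, f2) satisfies the symmetric form of the fourth Painlevé equation f_i' + f_i(f_{i+1} − f_{i+2}) = α_i for i = 0, 1, 2, and 2g'(x) + (f0(x) − x)² + (f1(x) − x)² + (f2(x)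 − x)² = 0 for all x. -/
/-- A nowhere-vanishing twice differentiable function satisfies the Riccati relation
`τ'' = ((τ'/τ)' + (τ'/τ)²) τ`. -/
theorem deriv_deriv_eq_of_ne_zero {τ : ℝ → ℂ} (hτ : Differentiable ℝ τ)
    (hτ' : Differentiable ℝ (deriv τ)) (hne : ∀ x, τ x ≠ 0) (x : ℝ) :
    deriv (deriv τ) x =
      (deriv (fun y => deriv τ y / τ y) x + (deriv τ x / τ x) ^ 2) * τ x := by
  have h := ((hτ' x).hasDerivAt.div (hτ x).hasDerivAt (hne x)).deriv
  change deriv (fun y => deriv τ y / τ y) x = _ at h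
  rw [h]
  field_simp [hne x]
  ring

/-- The Hirota bilinear equation in terms of the logarithmic derivatives. -/
theorem hirota_eq_zero_iff {τ σ : ℝ → ℂ} (hτ : Differentiable ℝ τ)
    (hτ' : Differentiable ℝ (deriv τ)) (hσ : Differentiable ℝ σ)
    (hσ' : Differentiable ℝ (deriv σ)) (hτne : ∀ x, τ x ≠ 0) (hσne : ∀ x, σ x ≠ 0)
    (c : ℂ) (x : ℝ) :
    deriv (deriv τ) x * σ x - 2 * deriv τ x * deriv σ x + τ x * deriv (deriv σ) x -
        x * (deriv τ x * σ x - τ x * deriv σ x) - c * (τ x * σ x) = 0 ↔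
      deriv (fun y => deriv τ y / τ y) x + deriv (fun y => deriv σ y / σ y) x +
        (deriv τ x / τ x - deriv σ x / σ x) ^ 2 -
        x * (deriv τ x / τ x - deriv σ x / σ x) - c = 0 := by
  rw [deriv_deriv_eq_of_ne_zero hτ hτ' hτne, deriv_deriv_eq_of_ne_zero hσ hσ' hσne]
  generalize deriv (fun y => deriv τ y / τ y) x = p
  generalize deriv (fun y => deriv σ y / σ y) x = q
  have hu : deriv τ x = deriv τ x / τ x * τ x := (div_mul_cancel₀ _ (hτne x)).symm
  have hv : deriv σ x = deriv σ x / σ x * σ x := (div_mul_cancel₀ _ (hσne x)).symm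
  generalize deriv τ x / τ x = u at *
  generalize deriv σ x / σ x = v at *
  rw [hu, hv]
  refine Iff.trans ?_ (mul_eq_zero_iff_left (mul_ne_zero (hτne x) (hσne x)))
  ring_nf

/-- The derivative of `u - v + x` for complex-valued functions of a real variable. -/
theorem deriv_sub_add_ofReal {u v : ℝ → ℂ} (hu : Differentiable ℝ u)
    (hv : Differentiable ℝ v) (x : ℝ) :
    deriv (fun y : ℝ => u y - v y + y) x = deriv u x - deriv v x + 1 :=
  (((hu x).hasDerivAt.sub (hv x).hasDerivAt).add Complex.ofRealCLM.hasDerivAt).deriv.trans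
    (by simp)


/-- **Equivalence of the bilinear (Hirota) form and the symmetric form of Painlevé IV.**
For twice differentiable nowhere-vanishing `τ₀, τ₁, τ₂ : ℝ → ℂ`, with
`fᵢ = τᵢ₊₁'/τᵢ₊₁ − τᵢ₊₂'/τᵢ₊₂ + x` (indices mod 3) and
`g = τ₀'/τ₀ + τ₁'/τ₁ + τ₂'/τ₂`, the three Hirota bilinear equations
`(Dₓ² − x Dₓ − (αᵢ − αᵢ₊₁)/3) τᵢ·τᵢ₊₁ = 0` hold iff `(f₀, f₁, f₂)` satisfies the
symmetric Painlevé IV system `fᵢ' + fᵢ(fᵢ₊₁ − fᵢ₊₂) = αᵢ` together with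
`2g' + (f₀ − x)² + (f₁ − x)² + (f₂ − x)² = 0`. -/
theorem bilinear_iff_symmetric_P4
    (α0 α1 α2 : ℂ) (hα : α0 + α1 + α2 = 3)
    (τ0 τ1 τ2 : ℝ → ℂ)
    (hτ0 : Differentiable ℝ τ0) (hτ0' : Differentiable ℝ (deriv τ0))
    (hτ1 : Differentiable ℝ τ1) (hτ1' : Differentiable ℝ (deriv τ1))
    (hτ2 : Differentiable ℝ τ2) (hτ2' : Differentiable ℝ (deriv τ2))
    (hne0 : ∀ x : ℝ, τ0 x ≠ 0) (hne1 : ∀ x : ℝ, τ1 x ≠ 0) (hne2 : ∀ x : ℝ, τ2 x ≠ 0)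
    (f0 f1 f2 g : ℝ → ℂ)
    (hf0 : f0 = fun x : ℝ => deriv τ1 x / τ1 x - deriv τ2 x / τ2 x + x)
    (hf1 : f1 = fun x : ℝ => deriv τ2 x / τ2 x - deriv τ0 x / τ0 x + x)
    (hf2 : f2 = fun x : ℝ => deriv τ0 x / τ0 x - deriv τ1 x / τ1 x + x)
    (hg : g = fun x : ℝ =>
      deriv τ0 x / τ0 x + deriv τ1 x / τ1 x + deriv τ2 x / τ2 x) :
    ((∀ x : ℝ, deriv (deriv τ0) x * τ1 x - 2 * deriv τ0 x * deriv τ1 x +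
        τ0 x * deriv (deriv τ1) x -
        x * (deriv τ0 x * τ1 x - τ0 x * deriv τ1 x) -
        (α0 - α1) / 3 * (τ0 x * τ1 x) = 0) ∧
     (∀ x : ℝ, deriv (deriv τ1) x * τ2 x - 2 * deriv τ1 x * deriv τ2 x +
        τ1 x * deriv (deriv τ2) x -
        x * (deriv τ1 x * τ2 x - τ1 x * deriv τ2 x) -
        (α1 - α2) / 3 * (τ1 x * τ2 x) = 0) ∧
     (∀ x : ℝ, deriv (deriv τ2) x * τ0 x - 2 * deriv τ2 x * deriv τ0 x +
        τ2 x * deriv (deriv τ0) x -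
        x * (deriv τ2 x * τ0 x - τ2 x * deriv τ0 x) -
        (α2 - α0) / 3 * (τ2 x * τ0 x) = 0)) ↔
    ((∀ x : ℝ, deriv f0 x + f0 x * (f1 x - f2 x) = α0) ∧
     (∀ x : ℝ, deriv f1 x + f1 x * (f2 x - f0 x) = α1) ∧
     (∀ x : ℝ, deriv f2 x + f2 x * (f0 x - f1 x) = α2) ∧
     (∀ x : ℝ, 2 * deriv g x + (f0 x - x) ^ 2 + (f1 x - x) ^ 2 +
        (f2 x - x) ^ 2 = 0)) := by
  have hu0 : Differentiable ℝ fun y => deriv τ0 y / τ0 y := hτ0'.div hτ0 hne0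
  have hu1 : Differentiable ℝ fun y => deriv τ1 y / τ1 y := hτ1'.div hτ1 hne1
  have hu2 : Differentiable ℝ fun y => deriv τ2 y / τ2 y := hτ2'.div hτ2 hne2
  have hdg (x : ℝ) : deriv g x = deriv (fun y => deriv τ0 y / τ0 y) x +
      deriv (fun y => deriv τ1 y / τ1 y) x + deriv (fun y => deriv τ2 y / τ2 y) x := by
    rw [hg]
    exact (((hu0 x).hasDerivAt.add (hu1 x).hasDerivAt).add (hu2 x).hasDerivAt).deriv
  have hd0 := deriv_sub_add_ofReal hu1 hu2
  have hd1 := deriv_sub_add_ofReal hu2 hu0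
  have hd2 := deriv_sub_add_ofReal hu0 hu1
  simp only [hirota_eq_zero_iff hτ0 hτ0' hτ1 hτ1' hne0 hne1,
    hirota_eq_zero_iff hτ1 hτ1' hτ2 hτ2' hne1 hne2,
    hirota_eq_zero_iff hτ2 hτ2' hτ0 hτ0' hne2 hne0, hdg, hf0, hf1, hf2, hd0, hd1, hd2]
  constructor
  · rintro ⟨h0, h1, h2⟩
    refine ⟨fun x => ?_, fun x => ?_, fun x => ?_, fun x => ?_⟩
    · linear_combination h0 x - h2 x - hα / 3
    · linear_combination h1 x - h0 x - hα / 3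
    · linear_combination h2 x - h1 x - hα / 3
    · linear_combination h0 x + h1 x + h2 x
  · rintro ⟨h0, h1, h2, h⟩
    refine ⟨fun x => ?_, fun x => ?_, fun x => ?_⟩
    · linear_combination (h x + h0 x - h1 x) / 3
    · linear_combination (h x + h1 x - h2 x) / 3
    · linear_combination (h x + h2 x - h0 x) / 3
end

section
/- Let α0, α1, α2 ∈ ℂ with α0 + α1 + α2 = 3, and let τ0, τ1, τ2 : ℝ → ℂ be three-times differentiable, nowhere-vanishing functions satisfying the bilinear form of the fourth Painlevé equation: (D_x² − x·D_x − (α_i − α_{i+1})/3) τ_i·τ_{i+1} = 0 for i = 0, 1, 2 (indices mod 3). Define σ0(x) = (τ1'(x)τ2(x) − τ1(x)τ2'(x) + x·τ1(x)τ2(x))/τ0(x). Then the triple (σ0, τ1, τ2) satisfies the bilinear form of the fourth Painlevé equation with parameters (−α0, α1 + α0, α2 + α0); explicitly, (D_x² − x·D_x + (2α0 + α1)/3) σ0·τ1 = 0, (D_x² − x·D_x − (α1 − α2)/3) τ1·τ2 = 0, and (D_x² − x·D_x − (α2 + 2α0)/3) τ2·σ0 = 0. -/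
/-- **The Bäcklund transformation `s₀` on the level of `τ`-functions.**
If `(τ₀, τ₁, τ₂)` satisfies the bilinear form of Painlevé IV
`(Dₓ² − x Dₓ − (αᵢ − αᵢ₊₁)/3) τᵢ·τᵢ₊₁ = 0` (indices mod 3, `α₀ + α₁ + α₂ = 3`),
and `σ₀ = (τ₁'τ₂ − τ₁τ₂' + x τ₁τ₂)/τ₀`, then `(σ₀, τ₁, τ₂)` satisfies the bilinear
form with parameters `(−α₀, α₁ + α₀, α₂ + α₀)`. -/
theorem backlund_s0_tau_functions
    (α0 α1 α2 : ℂ) (hα : α0 + α1 + α2 = 3)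
    (τ0 τ1 τ2 : ℝ → ℂ)
    (hτ0 : Differentiable ℝ τ0) (hτ0' : Differentiable ℝ (deriv τ0))
    (hτ0'' : Differentiable ℝ (deriv (deriv τ0)))
    (hτ1 : Differentiable ℝ τ1) (hτ1' : Differentiable ℝ (deriv τ1))
    (hτ1'' : Differentiable ℝ (deriv (deriv τ1)))
    (hτ2 : Differentiable ℝ τ2) (hτ2' : Differentiable ℝ (deriv τ2))
    (hτ2'' : Differentiable ℝ (deriv (deriv τ2)))
    (hne0 : ∀ x : ℝ, τ0 x ≠ 0) (hne1 : ∀ x : ℝ, τ1 x ≠ 0) (hne2 : ∀ x : ℝ, τ2 x ≠ 0)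
    (heq01 : ∀ x : ℝ, deriv (deriv τ0) x * τ1 x - 2 * deriv τ0 x * deriv τ1 x +
      τ0 x * deriv (deriv τ1) x - x * (deriv τ0 x * τ1 x - τ0 x * deriv τ1 x) -
      (α0 - α1) / 3 * (τ0 x * τ1 x) = 0)
    (heq12 : ∀ x : ℝ, deriv (deriv τ1) x * τ2 x - 2 * deriv τ1 x * deriv τ2 x +
      τ1 x * deriv (deriv τ2) x - x * (deriv τ1 x * τ2 x - τ1 x * deriv τ2 x) -
      (α1 - α2) / 3 * (τ1 x * τ2 x) = 0)
    (heq20 : ∀ x : ℝ, deriv (deriv τ2) x * τ0 x - 2 * deriv τ2 x * deriv τ0 x +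
      τ2 x * deriv (deriv τ0) x - x * (deriv τ2 x * τ0 x - τ2 x * deriv τ0 x) -
      (α2 - α0) / 3 * (τ2 x * τ0 x) = 0)
    (σ0 : ℝ → ℂ)
    (hσ0 : σ0 = fun x : ℝ =>
      (deriv τ1 x * τ2 x - τ1 x * deriv τ2 x + x * (τ1 x * τ2 x)) / τ0 x) :
    (∀ x : ℝ, deriv (deriv σ0) x * τ1 x - 2 * deriv σ0 x * deriv τ1 x +
      σ0 x * deriv (deriv τ1) x - x * (deriv σ0 x * τ1 x - σ0 x * deriv τ1 x) +
      (2 * α0 + α1) / 3 * (σ0 x * τ1 x) = 0) ∧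
    (∀ x : ℝ, deriv (deriv τ1) x * τ2 x - 2 * deriv τ1 x * deriv τ2 x +
      τ1 x * deriv (deriv τ2) x - x * (deriv τ1 x * τ2 x - τ1 x * deriv τ2 x) -
      (α1 - α2) / 3 * (τ1 x * τ2 x) = 0) ∧
    (∀ x : ℝ, deriv (deriv τ2) x * σ0 x - 2 * deriv τ2 x * deriv σ0 x +
      τ2 x * deriv (deriv σ0) x - x * (deriv τ2 x * σ0 x - τ2 x * deriv σ0 x) -
      (α2 + 2 * α0) / 3 * (τ2 x * σ0 x) = 0) := by
  have hσ : ∀ x : ℝ, σ0 x * τ0 x =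
      deriv τ1 x * τ2 x - τ1 x * deriv τ2 x + x * (τ1 x * τ2 x) := fun x => by
    rw [hσ0]
    exact div_mul_cancel₀ _ (hne0 x)
  have hid : Differentiable ℝ (fun x : ℝ => (x : ℂ)) := Complex.ofRealCLM.differentiable
  have hdσ : Differentiable ℝ σ0 := by
    rw [hσ0]
    exact (((hτ1'.mul hτ2).sub (hτ1.mul hτ2')).add (hid.mul (hτ1.mul hτ2))).div hτ0 hne0
  -- the bilinear relation `Dₓ σ₀·τ₀ = α₀ τ₁ τ₂`
  have hσ' : ∀ x : ℝ, deriv σ0 x * τ0 x = α0 * (τ1 x * τ2 x) + σ0 x * deriv τ0 x := fun x => by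
    have hl := (hdσ x).hasDerivAt.mul (hτ0 x).hasDerivAt
    have hr := (((hτ1' x).hasDerivAt.mul (hτ2 x).hasDerivAt).sub
      ((hτ1 x).hasDerivAt.mul (hτ2' x).hasDerivAt)).add
      ((Complex.ofRealCLM.hasDerivAt (x := x)).mul
        ((hτ1 x).hasDerivAt.mul (hτ2 x).hasDerivAt))
    have h := hl.unique (hr.congr_of_eventuallyEq (.of_forall hσ))
    simp only [Complex.ofRealCLM_apply, Complex.ofReal_one, Pi.mul_apply] at h
    apply mul_left_cancel₀ (hne0 x)
    linear_combination τ0 x * h + τ2 x * heq01 x - τ1 x * heq20 x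
      - 2 * deriv τ0 x * hσ x - τ0 x * τ1 x * τ2 x / 3 * hα
  have hdσ' : Differentiable ℝ (deriv σ0) := by
    have h : deriv σ0 = fun x => (α0 * (τ1 x * τ2 x) + σ0 x * deriv τ0 x) / τ0 x :=
      funext fun x => eq_div_of_mul_eq (hne0 x) (hσ' x)
    rw [h]
    exact (((hτ1.mul hτ2).const_mul α0).add (hdσ.mul hτ0')).div hτ0 hne0
  have hσ'' : ∀ x : ℝ, deriv (deriv σ0) x * τ0 x =
      α0 * (deriv τ1 x * τ2 x + τ1 x * deriv τ2 x) + σ0 x * deriv (deriv τ0) x := fun x => by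
    have hl := (hdσ' x).hasDerivAt.mul (hτ0 x).hasDerivAt
    have hr := (((hτ1 x).hasDerivAt.mul (hτ2 x).hasDerivAt).const_mul α0).add
      ((hdσ x).hasDerivAt.mul (hτ0' x).hasDerivAt)
    have h := hl.unique (hr.congr_of_eventuallyEq (.of_forall hσ'))
    linear_combination h
  refine ⟨fun x => ?_, heq12, fun x => ?_⟩ <;> apply mul_left_cancel₀ (hne0 x)
  · linear_combination τ1 x * hσ'' x - (2 * deriv τ1 x + x * τ1 x) * hσ' x
      + σ0 x * heq01 x + α0 * τ1 x * hσ x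
  · linear_combination τ2 x * hσ'' x + (x * τ2 x - 2 * deriv τ2 x) * hσ' x
      + σ0 x * heq20 x - α0 * τ2 x * hσ x
end

section
/- Let α0, α1, α2 ∈ ℂ with α0 + α1 + α2 = 3, and let τ0, τ1, τ2 : ℝ → ℂ be twice differentiable, nowhere-vanishing functions satisfying the bilinear form of the fourth Painlevé equation: (D_x² − x·D_x − (α_i − α_{i+1})/3) τ_i·τ_{i+1} = 0 for i = 0, 1, 2 (indices mod 3). Then the Toda-type equation holds: for all x, τ1(x)τ2(x)·( τ0''(x)τ0(x) − τ0'(x)² + (x² + (α1 − α2)/3)·τ0(x)² ) = ( τ2'(x)τ0(x) − τ2(x)τ0'(x) + x·τ2(x)τ0(x) )·( τ0'(x)τ1(x) − τ0(x)τ1'(x) + x·τ0(x)τ1(x) ). -/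
/-- **Toda-type equation for the `τ`-functions of Painlevé IV.**
If `(τ₀, τ₁, τ₂)` satisfies the bilinear form of Painlevé IV
`(Dₓ² − x Dₓ − (αᵢ − αᵢ₊₁)/3) τᵢ·τᵢ₊₁ = 0` (indices mod 3, `α₀ + α₁ + α₂ = 3`),
then `τ₁τ₂ (τ₀''τ₀ − τ₀'² + (x² + (α₁ − α₂)/3) τ₀²)
  = (τ₂'τ₀ − τ₂τ₀' + x τ₂τ₀)(τ₀'τ₁ − τ₀τ₁' + x τ₀τ₁)`. -/
theorem toda_equation_for_tau
    (α0 α1 α2 : ℂ) (hα : α0 + α1 + α2 = 3)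
    (τ0 τ1 τ2 : ℝ → ℂ)
    (hτ0 : Differentiable ℝ τ0) (hτ0' : Differentiable ℝ (deriv τ0))
    (hτ1 : Differentiable ℝ τ1) (hτ1' : Differentiable ℝ (deriv τ1))
    (hτ2 : Differentiable ℝ τ2) (hτ2' : Differentiable ℝ (deriv τ2))
    (hne0 : ∀ x : ℝ, τ0 x ≠ 0) (hne1 : ∀ x : ℝ, τ1 x ≠ 0) (hne2 : ∀ x : ℝ, τ2 x ≠ 0)
    (heq01 : ∀ x : ℝ, deriv (deriv τ0) x * τ1 x - 2 * deriv τ0 x * deriv τ1 x +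
      τ0 x * deriv (deriv τ1) x - x * (deriv τ0 x * τ1 x - τ0 x * deriv τ1 x) -
      (α0 - α1) / 3 * (τ0 x * τ1 x) = 0)
    (heq12 : ∀ x : ℝ, deriv (deriv τ1) x * τ2 x - 2 * deriv τ1 x * deriv τ2 x +
      τ1 x * deriv (deriv τ2) x - x * (deriv τ1 x * τ2 x - τ1 x * deriv τ2 x) -
      (α1 - α2) / 3 * (τ1 x * τ2 x) = 0)
    (heq20 : ∀ x : ℝ, deriv (deriv τ2) x * τ0 x - 2 * deriv τ2 x * deriv τ0 x +
      τ2 x * deriv (deriv τ0) x - x * (deriv τ2 x * τ0 x - τ2 x * deriv τ0 x) -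
      (α2 - α0) / 3 * (τ2 x * τ0 x) = 0) :
    ∀ x : ℝ, τ1 x * τ2 x *
      (deriv (deriv τ0) x * τ0 x - (deriv τ0 x) ^ 2 +
        ((x : ℂ) ^ 2 + (α1 - α2) / 3) * (τ0 x) ^ 2) =
      (deriv τ2 x * τ0 x - τ2 x * deriv τ0 x + x * (τ2 x * τ0 x)) *
      (deriv τ0 x * τ1 x - τ0 x * deriv τ1 x + x * (τ0 x * τ1 x)) := by
  intro x
  linear_combination (τ2 x * τ0 x / 2) * heq01 x + (τ1 x * τ0 x / 2) * heq20 x -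
    (τ0 x ^ 2 / 2) * heq12 x
end

section
/- Let d0, d1 ∈ ℂ and k ∈ ℝ with k ≠ 0. Let G0, G1 : ℝ² → ℂ be twice continuously differentiable functions of (t1, t2) satisfying on ℝ² the homogeneity (Euler) equations t1·∂G_i/∂t1 + 2t2·∂G_i/∂t2 = d_i·G_i for i = 0, 1, and the Hirota bilinear equation (D_{t1}² + D_{t2}) G0·G1 = 0, i.e. (∂1²G0)G1 − 2(∂1G0)(∂1G1) + G0(∂1²G1) + (∂2G0)G1 − G0(∂2G1) = 0. Then the one-variable functions τ_i(x) := G_i(x, k) satisfy the Hirota bilinear equation (2k·D_x² − x·D_x + (d0 − d1)) τ0·τ1 = 0, i.e. 2k(τ0''τ1 − 2τ0'τ1' + τ0τ1'') − x(τ0'τ1 − τ0τ1') + (d0 − d1)τ0τ1 = 0 for all x ∈ ℝ. -/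
/-- **Similarity reduction lemma.**  Let `G₀, G₁ : ℝ² → ℂ` be `C²` functions which are
homogeneous of degrees `d₀, d₁` for the weights `deg t₁ = 1`, `deg t₂ = 2`
(Euler equations `t₁ ∂₁Gᵢ + 2 t₂ ∂₂Gᵢ = dᵢ Gᵢ`) and satisfy the modified-KP Hirota
bilinear equation `(D_{t₁}² + D_{t₂}) G₀·G₁ = 0`.  Then for `k ≠ 0`, the functions
`τᵢ(x) = Gᵢ(x, k)` satisfy `(2k Dₓ² − x Dₓ + (d₀ − d₁)) τ₀·τ₁ = 0`. -/
theorem similarity_reduction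
    (d0 d1 : ℂ) (k : ℝ) (hk : k ≠ 0)
    (G0 G1 : ℝ → ℝ → ℂ)
    (hG0 : ContDiff ℝ 2 (Function.uncurry G0))
    (hG1 : ContDiff ℝ 2 (Function.uncurry G1))
    (hEuler0 : ∀ t1 t2 : ℝ,
      (t1 : ℂ) * deriv (fun s => G0 s t2) t1 +
        2 * (t2 : ℂ) * deriv (fun s => G0 t1 s) t2 = d0 * G0 t1 t2)
    (hEuler1 : ∀ t1 t2 : ℝ,
      (t1 : ℂ) * deriv (fun s => G1 s t2) t1 +
        2 * (t2 : ℂ) * deriv (fun s => G1 t1 s) t2 = d1 * G1 t1 t2)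
    (hHirota : ∀ t1 t2 : ℝ,
      deriv (deriv (fun s => G0 s t2)) t1 * G1 t1 t2 -
        2 * deriv (fun s => G0 s t2) t1 * deriv (fun s => G1 s t2) t1 +
        G0 t1 t2 * deriv (deriv (fun s => G1 s t2)) t1 +
        deriv (fun s => G0 t1 s) t2 * G1 t1 t2 -
        G0 t1 t2 * deriv (fun s => G1 t1 s) t2 = 0)
    (τ0 τ1 : ℝ → ℂ)
    (hτ0 : τ0 = fun x : ℝ => G0 x k) (hτ1 : τ1 = fun x : ℝ => G1 x k) :
    ∀ x : ℝ,
      2 * (k : ℂ) * (deriv (deriv τ0) x * τ1 x - 2 * deriv τ0 x * deriv τ1 x +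
        τ0 x * deriv (deriv τ1) x) -
      x * (deriv τ0 x * τ1 x - τ0 x * deriv τ1 x) +
      (d0 - d1) * (τ0 x * τ1 x) = 0 := by
  subst hτ0 hτ1
  intro x
  linear_combination 2 * (k : ℂ) * hHirota x k - G1 x k * hEuler0 x k + G0 x k * hEuler1 x k
end

section
/- For every pair of integers m, n ∈ ℤ, the triple of polynomials (τ0, τ1, τ2) = (s_{m,n}, s_{m+1,n}, s_{m+1,n+1}) satisfies the bilinear form of the fourth Painlevé equation with parameters (α0, α1, α2) = (3m + 1, 3(n − m) + 1, −3n + 1); explicitly, (D_x² − x·D_x − (α_i − α_{i+1})/3) τ_i·τ_{i+1} = 0 for i = 0, 1, 2 (indices mod 3), where (D_x² − x·D_x − c) F·G = F''G − 2F'G' + FG'' − x(F'G − FG') − c·FG. -/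
/-- `p2 c n` is the two-variable polynomial `p_n(t₁, t₂) = ∑_{i+2j=n} t₁^i t₂^j/(i!·j!)`
with the second variable specialized to `t₂ = c`, as a polynomial in `x = t₁`. -/
noncomputable def p2 (c : ℂ) (n : ℕ) : Polynomial ℂ :=
  ∑ j ∈ Finset.range (n / 2 + 1),
    Polynomial.C (c ^ j / ((Nat.factorial (n - 2 * j) : ℂ) * (Nat.factorial j : ℂ))) *
      Polynomial.X ^ (n - 2 * j)

/-- `p_m(x, c)` for an integer index, with `p_m = 0` for `m < 0`. -/
noncomputable def p2Z (c : ℂ) (m : ℤ) : Polynomial ℂ :=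
  if 0 ≤ m then p2 c m.toNat else 0

/-- The Jacobi–Trudi determinant `S_λ(x, c) = det(p_{λᵢ−i+j}(x, c))_{1≤i,j≤ℓ}`, for a
partition recorded as `lam : ℕ → ℕ` (so `λ_{i+1} = lam i`) of length at most `ℓ`. -/
noncomputable def jacobiTrudi (c : ℂ) (ℓ : ℕ) (lam : ℕ → ℕ) : Polynomial ℂ :=
  Matrix.det (Matrix.of fun i j : Fin ℓ =>
    p2Z c ((lam i : ℤ) - (i : ℕ) + (j : ℕ)))

/-- The Maya diagram `M(m,n) = {3k : k < m} ∪ {3k+1 : k < n} ∪ {3k+2 : k < 0} ⊂ ℤ`. -/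
def mayaSet (m n : ℤ) : Set ℤ :=
  {z | ∃ k < m, z = 3 * k} ∪ {z | ∃ k < n, z = 3 * k + 1} ∪
    {z | ∃ k < (0 : ℤ), z = 3 * k + 2}

/-- `lam : ℕ → ℕ` (with `λ_{i+1} = lam i`) is the partition associated to the Maya
diagram `M`, with `c` the eventually constant value of `mᵢ + i`: i.e. `lam` is weakly
decreasing, eventually `0`, and `i ↦ λ_{i+1} − (i+1) + c` is the (strictly decreasing)
enumeration of `M`, i.e. its range is exactly `M`. -/
def IsMayaPartition (M : Set ℤ) (lam : ℕ → ℕ) (c : ℤ) : Prop :=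
  Antitone lam ∧ (∃ N, ∀ i, N ≤ i → lam i = 0) ∧
    Set.range (fun i : ℕ => (lam i : ℤ) - ((i : ℤ) + 1) + c) = M

/-- `s` is the 3-reduced Schur polynomial `s_{m,n}(x) = S_{λ(m,n)}(x, 1/2)`, where
`λ(m,n)` is the partition associated to the Maya diagram `M(m,n)`. -/
def IsOkamotoS (m n : ℤ) (s : Polynomial ℂ) : Prop :=
  ∃ (lam : ℕ → ℕ) (c : ℤ) (ℓ : ℕ),
    IsMayaPartition (mayaSet m n) lam c ∧ (∀ i, ℓ ≤ i → lam i = 0) ∧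
    s = jacobiTrudi (1 / 2) ℓ lam

/-- The Hirota bilinear expression `(Dₓ² − x·Dₓ − c) F·G` for polynomials. -/
noncomputable def hirotaBil (c : ℂ) (F G : Polynomial ℂ) : Polynomial ℂ :=
  Polynomial.derivative (Polynomial.derivative F) * G -
    2 * Polynomial.derivative F * Polynomial.derivative G +
    F * Polynomial.derivative (Polynomial.derivative G) -
    Polynomial.X * (Polynomial.derivative F * G - F * Polynomial.derivative G) -
    Polynomial.C c * (F * G)

open Polynomial

theorem coeff_p2 (c : ℂ) (n i : ℕ) : (p2 c n).coeff i =
    if i ≤ n ∧ Even (n - i) then c ^ ((n - i) / 2) / ((i.factorial : ℂ) * ((n - i) / 2).factorial)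
      else 0 := by
  simp only [p2, finsetSum_coeff, coeff_C_mul_X_pow]
  split_ifs with h
  · obtain ⟨h, k, hk⟩ := h
    have hk' : (n - i) / 2 = k := by omega
    rw [Finset.sum_eq_single k]
    · rw [if_pos (by omega), hk', show n - 2 * k = i by omega]
    · intro j hj hjk
      rw [if_neg]
      simp only [Finset.mem_range] at hj
      omega
    · intro hj
      simp only [Finset.mem_range] at hj
      omega
  · refine Finset.sum_eq_zero fun j hj => if_neg fun hi => h ?_
    simp only [Finset.mem_range] at hj
    exact ⟨by omega, j, by omega⟩

theorem derivative_p2_succ (c : ℂ) (n : ℕ) : derivative (p2 c (n + 1)) = p2 c n := by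
  ext i
  rw [coeff_derivative, coeff_p2, coeff_p2]
  simp only [add_le_add_iff_right, Nat.add_sub_add_right]
  split_ifs
  · have := Nat.cast_add_one_ne_zero (R := ℂ) i
    rw [Nat.factorial_succ]
    push_cast
    field_simp
  · simp

theorem p2_zero (c : ℂ) : p2 c 0 = 1 := by
  simp [p2]

theorem derivative_p2Z (c : ℂ) (m : ℤ) : derivative (p2Z c m) = p2Z c (m - 1) := by
  unfold p2Z
  rcases lt_trichotomy m 0 with h | rfl | h
  · rw [if_neg (by omega), if_neg (by omega), derivative_zero]
  · simp [p2_zero]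
  · obtain ⟨k, rfl⟩ : ∃ k : ℕ, m = (k + 1 : ℕ) := ⟨m.toNat - 1, by omega⟩
    rw [if_pos (by omega), if_pos (by omega), Int.toNat_natCast, derivative_p2_succ]
    congr
    omega

theorem p2_hermite (n : ℕ) :
    derivative (derivative (p2 (1 / 2) n)) + X * derivative (p2 (1 / 2) n)
      = (n : ℂ[X]) * p2 (1 / 2) n := by
  ext i
  have key : ((i : ℂ) + 1) * (i + 2) * (p2 (1 / 2) n).coeff (i + 2)
      = (n - i) * (p2 (1 / 2) n).coeff i := by
    rw [coeff_p2, coeff_p2]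
    by_cases h : i + 2 ≤ n ∧ Even (n - i)
    · obtain ⟨h1, k, hk⟩ := h
      obtain ⟨k, rfl⟩ : ∃ l, k = l + 1 := ⟨k - 1, by omega⟩
      rw [if_pos ⟨h1, k, by omega⟩, if_pos ⟨by omega, k + 1, hk⟩,
        show (n - (i + 2)) / 2 = k by omega, show (n - i) / 2 = k + 1 by omega,
        show (n : ℂ) = i + 2 * (k + 1) by
          exact_mod_cast (show n = i + 2 * (k + 1) by omega)]
      have := Nat.cast_add_one_ne_zero (R := ℂ) i
      have := Nat.cast_add_one_ne_zero (R := ℂ) k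
      have : (i : ℂ) + 2 ≠ 0 := by exact_mod_cast (show i + 2 ≠ 0 by omega)
      have := Nat.cast_ne_zero (R := ℂ).2 i.factorial_ne_zero
      have := Nat.cast_ne_zero (R := ℂ).2 k.factorial_ne_zero
      simp only [Nat.factorial_succ]
      push_cast
      rw [show (i : ℂ) + 1 + 1 = i + 2 by ring]
      field_simp
      ring
    · rw [if_neg fun h' => h ⟨h'.1, by
        rw [Nat.even_sub (by omega)] at h' ⊢
        simpa [parity_simps] using h'.2⟩]
      split_ifs with h'
      · obtain rfl : i = n := by
          obtain ⟨h1, k, hk⟩ := h'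
          by_contra hne
          exact h ⟨by omega, k, hk⟩
        simp
      · simp
  rw [coeff_add, coeff_natCast_mul, coeff_derivative, coeff_derivative]
  have hX : (X * derivative (p2 (1 / 2) n)).coeff i = i * (p2 (1 / 2) n).coeff i := by
    cases i with
    | zero => simp
    | succ i => rw [coeff_X_mul, coeff_derivative]; push_cast; ring
  rw [hX]
  push_cast
  linear_combination key

/-- The Wronskian of `f 0, …, f (n - 1)`. -/
noncomputable def wronskianDet {n : ℕ} (f : Fin n → ℂ[X]) : ℂ[X] :=
  Matrix.det (Matrix.of fun i j : Fin n => derivative^[j] (f i))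

theorem derivative_det {n : ℕ} (M : Matrix (Fin n) (Fin n) ℂ[X]) :
    derivative M.det = ∑ j, (M.updateCol j fun i => derivative (M i j)).det := by
  simp only [Matrix.det_apply, derivative_sum]
  rw [Finset.sum_comm]
  refine Finset.sum_congr rfl fun σ _ => ?_
  rw [← Finset.smul_sum, Units.smul_def, derivative_smul, derivative_prod_finset, Units.smul_def]
  congr 1
  refine Finset.sum_congr rfl fun j _ => ?_
  rw [← Finset.mul_prod_erase _ _ (Finset.mem_univ j), mul_comm]
  congr 1
  · simp
  · refine Finset.prod_congr rfl fun k hk => ?_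
    rw [Matrix.updateCol_ne (Finset.ne_of_mem_erase hk)]

theorem derivative_wronskianDet {n : ℕ} (f : Fin (n + 1) → ℂ[X]) :
    derivative (wronskianDet f) =
      Matrix.det (Matrix.of fun i j : Fin (n + 1) =>
        derivative^[if j = Fin.last n then n + 1 else j] (f i)) := by
  rw [wronskianDet, derivative_det, Finset.sum_eq_single (Fin.last n)]
  · congr 1
    ext1 i j
    by_cases h : j = Fin.last n
    · subst h
      simp [Function.iterate_succ_apply']
    · simp [h, Matrix.updateCol_ne]
  · intro j _ hj
    have hj' : (j : ℕ) < n := Fin.val_lt_last hj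
    refine Matrix.det_zero_of_column_eq (i := j) (j := ⟨j + 1, by omega⟩) ?_ ?_
    · intro h
      have := congrArg Fin.val h
      simp at this
    · intro i
      rw [Matrix.updateCol_self, Matrix.updateCol_ne]
      · simp [Function.iterate_succ_apply']
      · intro h
        have := congrArg Fin.val h
        simp at this
  · simp

theorem wronskianDet_snoc {n : ℕ} (f : Fin (n + 1) → ℂ[X]) :
    ∃ A : ℕ → ℂ[X], ∀ h : ℂ[X], wronskianDet (Fin.snoc (α := fun _ => ℂ[X]) f h) =
      wronskianDet f * derivative^[n + 1] h - derivative (wronskianDet f) * derivative^[n] h +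
        ∑ j ∈ Finset.range n, A j * derivative^[j] h := by
  let B : Fin (n + 2) → ℂ[X] := fun j => (-1) ^ (n + 1 + (j : ℕ)) *
    (Matrix.of fun i k : Fin (n + 1) => derivative^[j.succAbove k] (f i)).det
  have hB (h : ℂ[X]) : wronskianDet (Fin.snoc (α := fun _ => ℂ[X]) f h) =
      ∑ j, B j * derivative^[j] h := by
    rw [wronskianDet, Matrix.det_succ_row _ (Fin.last (n + 1))]
    refine Finset.sum_congr rfl fun j _ => ?_
    have : (Matrix.of fun i j : Fin (n + 2) =>
        derivative^[j] (Fin.snoc (α := fun _ => ℂ[X]) f h i)).submatrix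
          (Fin.last (n + 1)).succAbove j.succAbove
        = Matrix.of fun i k : Fin (n + 1) => derivative^[j.succAbove k] (f i) := by
      ext1 i k
      simp
    rw [this]
    simp only [B, Matrix.of_apply, Fin.snoc_last, Fin.val_last]
    ring
  have h1 : B (Fin.last (n + 1)) = wronskianDet f := by
    simp only [B, Fin.val_last, Fin.succAbove_last, Fin.val_castSucc, wronskianDet]
    rw [Even.neg_one_pow ⟨n + 1, rfl⟩, one_mul]
  have h2 : B (Fin.last n).castSucc = -derivative (wronskianDet f) := by
    rw [derivative_wronskianDet]
    simp only [B, Fin.val_castSucc, Fin.val_last]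
    rw [Odd.neg_one_pow ⟨n, by ring⟩, neg_one_mul]
    congr 3
    ext1 i
    ext1 k
    congr 2
    split_ifs with hk
    · subst hk
      simp
    · have : (k : ℕ) < n := Fin.val_lt_last hk
      rw [Fin.succAbove_of_castSucc_lt _ _ (by simpa [Fin.lt_def] using this)]
      simp
  refine ⟨fun j => if hj : j < n then B ⟨j, by omega⟩ else 0, fun h => ?_⟩
  rw [hB, Fin.sum_univ_castSucc, Fin.sum_univ_castSucc, h1, h2, Finset.sum_range]
  simp only [Fin.is_lt, dite_true, Fin.val_castSucc, Fin.val_last]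
  have : ∀ j : Fin n, B j.castSucc.castSucc = B ⟨j, by omega⟩ := fun j => rfl
  simp only [this]
  ring

/-- Linear differential operators of order less than `m` with polynomial coefficients. -/
noncomputable def diffOpLT (m : ℕ) : Submodule ℂ[X] (ℂ[X] → ℂ[X]) :=
  Submodule.span ℂ[X] (Set.range fun j : Fin m => derivative^[j])

theorem mul_iterate_derivative_mem_diffOpLT {m j : ℕ} (hj : j < m) (r : ℂ[X]) :
    (fun h => r * derivative^[j] h) ∈ diffOpLT m :=
  Submodule.smul_mem _ r (Submodule.subset_span ⟨⟨j, hj⟩, rfl⟩)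

theorem sum_iterate_derivative_mem_diffOpLT {n m i : ℕ} (hm : n + i ≤ m) (r : ℕ → ℂ[X]) :
    (fun h => ∑ j ∈ Finset.range n, r j * derivative^[j + i] h) ∈ diffOpLT m := by
  have : (fun h => ∑ j ∈ Finset.range n, r j * derivative^[j + i] h)
      = ∑ j ∈ Finset.range n, fun h => r j * derivative^[j + i] h := by
    ext1 h
    simp
  rw [this]
  refine Submodule.sum_mem _ fun j hj => mul_iterate_derivative_mem_diffOpLT ?_ _
  have := Finset.mem_range.1 hj
  omega

theorem diffOpLT_eq_zero {m : ℕ} {f : Fin m → ℂ[X]} (hf : wronskianDet f ≠ 0)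
    {T : ℂ[X] → ℂ[X]} (hT : T ∈ diffOpLT m) (h : ∀ i, T (f i) = 0) : T = 0 := by
  obtain ⟨r, rfl⟩ := (Submodule.mem_span_range_iff_exists_fun _).1 hT
  have : r = 0 := by
    refine Matrix.eq_zero_of_mulVec_eq_zero hf ?_
    ext1 i
    have := h i
    simp only [Finset.sum_apply, Pi.smul_apply, smul_eq_mul] at this
    simpa [Matrix.mulVec, dotProduct, mul_comm] using this
  simp [this]

theorem iterate_derivative_hermite (h : ℂ[X]) (j : ℕ) :
    derivative^[j] (derivative (derivative h) + X * derivative h) =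
      derivative^[j + 2] h + X * derivative^[j + 1] h + (j : ℂ[X]) * derivative^[j] h := by
  induction j with
  | zero => simp
  | succ j ih =>
    rw [Function.iterate_succ_apply', ih]
    simp only [derivative_add, derivative_mul, derivative_X, derivative_natCast,
      ← Function.iterate_succ_apply' (f := derivative)]
    push_cast
    ring

theorem hirotaBil_wronskianDet {n : ℕ} (f : Fin (n + 1) → ℂ[X]) (g : ℂ[X])
    (κ : Fin (n + 1) → ℂ) (k : ℂ)
    (hf : ∀ i, derivative (derivative (f i)) + X * derivative (f i) = C (κ i) * f i)
    (hg : derivative (derivative g) + X * derivative g = C k * g) :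
    hirotaBil (k - (n + 1)) (wronskianDet f)
      (wronskianDet (Fin.snoc (α := fun _ => ℂ[X]) f g)) = 0 := by
  by_cases h0 : wronskianDet f = 0
  · simp [h0, hirotaBil]
  obtain ⟨A, hA⟩ := wronskianDet_snoc f
  set H : ℂ[X] → ℂ[X] := fun h => wronskianDet (Fin.snoc (α := fun _ => ℂ[X]) f h) with hH
  change ∀ h, H h = _ at hA
  change hirotaBil _ _ (H g) = 0
  have hHf (i) : H (f i) = 0 := by
    refine Matrix.det_zero_of_row_eq (i := i.castSucc) (j := Fin.last (n + 1))
      (Fin.castSucc_lt_last i).ne ?_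
    ext1 j
    simp
  have hHC (c : ℂ) (h) : H (C c * h) = C c * H h := by
    simp only [hA, iterate_derivative_C_mul, mul_add, mul_sub, Finset.mul_sum]
    simp only [mul_left_comm]
  clear_value H
  clear hH
  have hzero (T : ℂ[X] → ℂ[X]) (hT : T ∈ diffOpLT (n + 1)) (h : ∀ i, T (f i) = 0) : T = 0 :=
    diffOpLT_eq_zero h0 hT h
  generalize wronskianDet f = τ at *
  have hT := hzero (fun h =>
    τ * (H (derivative (derivative h) + X * derivative h) - derivative (derivative (H h)))
      - (X * τ - 2 * derivative τ) * derivative (H h)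
      - (((n : ℂ[X]) + 1) * τ - X * derivative τ + derivative (derivative τ)) * H h) ?_
    fun i => by simp only [hf, hHC, hHf]; simp
  · have hTg := congrFun hT g
    simp only [hg, hHC, Pi.zero_apply] at hTg
    simp only [hirotaBil, C_sub, C_add, C_1, map_natCast]
    linear_combination -hTg
  · let r₁ : ℕ → ℂ[X] := fun j => 2 * derivative τ * A j - 2 * τ * derivative (A j)
    let r₀ : ℕ → ℂ[X] := fun j => τ * ((j : ℂ[X]) * A j - derivative (derivative (A j)))
      - (X * τ - 2 * derivative τ) * derivative (A j)
      - (((n : ℂ[X]) + 1) * τ - X * derivative τ + derivative (derivative τ)) * A j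
    let e : ℂ[X] := τ * (derivative (derivative (derivative τ)) - (n : ℂ[X]) * derivative τ)
      + (X * τ - 2 * derivative τ) * derivative (derivative τ)
      + (((n : ℂ[X]) + 1) * τ - X * derivative τ + derivative (derivative τ)) * derivative τ
    have hmem := Submodule.add_mem _ (Submodule.add_mem _
      (mul_iterate_derivative_mem_diffOpLT n.lt_succ_self e)
      (sum_iterate_derivative_mem_diffOpLT (n := n) (i := 1) le_rfl r₁))
      (sum_iterate_derivative_mem_diffOpLT (n := n) (i := 0) n.le_succ r₀)
    convert hmem using 1
    ext1 h
    have hsum : ∑ j ∈ Finset.range n, r₁ j * derivative^[j + 1] h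
        + ∑ j ∈ Finset.range n, r₀ j * derivative^[j + 0] h
        = τ * (∑ j ∈ Finset.range n,
              A j * derivative^[j] (derivative (derivative h) + X * derivative h)
            - derivative (derivative (∑ j ∈ Finset.range n, A j * derivative^[j] h)))
          - (X * τ - 2 * derivative τ) * derivative (∑ j ∈ Finset.range n, A j * derivative^[j] h)
          - (((n : ℂ[X]) + 1) * τ - X * derivative τ + derivative (derivative τ))
            * ∑ j ∈ Finset.range n, A j * derivative^[j] h := by
      simp only [derivative_sum, Finset.mul_sum, ← Finset.sum_sub_distrib,
        ← Finset.sum_add_distrib]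
      refine Finset.sum_congr rfl fun j _ => ?_
      simp only [iterate_derivative_hermite, derivative_add, derivative_mul,
        ← Function.iterate_succ_apply' (f := derivative), r₁, r₀, add_zero]
      ring
    simp only [Pi.add_apply]
    rw [add_assoc, hsum]
    simp only [hA]
    generalize ∑ j ∈ Finset.range n,
      A j * derivative^[j] (derivative (derivative h) + X * derivative h) = S₁
    generalize ∑ j ∈ Finset.range n, A j * derivative^[j] h = S₀
    simp only [iterate_derivative_hermite, derivative_add, derivative_sub, derivative_mul,
        ← Function.iterate_succ_apply' (f := derivative), e]
    push_cast
    ring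

theorem jacobiTrudi_succ (c : ℂ) (ℓ : ℕ) (lam : ℕ → ℕ) (h : lam ℓ = 0) :
    jacobiTrudi c (ℓ + 1) lam = jacobiTrudi c ℓ lam := by
  rw [jacobiTrudi, Matrix.det_succ_row _ (Fin.last ℓ), Finset.sum_eq_single (Fin.last ℓ)]
  · simp only [Fin.val_last, Matrix.of_apply, h, Fin.succAbove_last]
    rw [Even.neg_one_pow ⟨ℓ, rfl⟩, one_mul]
    simp only [p2Z, Nat.cast_zero, zero_sub, neg_add_cancel, le_refl, if_true, Int.toNat_zero,
      p2_zero, one_mul]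
    rfl
  · intro j _ hj
    have : (j : ℕ) < ℓ := Fin.val_lt_last hj
    simp only [Fin.val_last, Matrix.of_apply, h, p2Z]
    rw [if_neg (by push_cast; omega)]
    simp
  · simp

theorem jacobiTrudi_eq_of_le (c : ℂ) {ℓ k : ℕ} {lam : ℕ → ℕ} (h : ∀ i, ℓ ≤ i → lam i = 0)
    (hk : ℓ ≤ k) : jacobiTrudi c k lam = jacobiTrudi c ℓ lam := by
  induction k, hk using Nat.le_induction with
  | base => rfl
  | succ k hk ih => rw [jacobiTrudi_succ c k lam (h k hk), ih]

theorem iterate_derivative_p2 (c : ℂ) (k j : ℕ) :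
    derivative^[j] (p2 c k) = p2Z c ((k : ℤ) - j) := by
  induction j with
  | zero => simp [p2Z]
  | succ j ih =>
    rw [Function.iterate_succ_apply', ih, derivative_p2Z]
    congr 1
    push_cast
    ring

theorem jacobiTrudi_eq_wronskianDet (c : ℂ) (n : ℕ) (lam : ℕ → ℕ) :
    ∃ ε : ℤ, jacobiTrudi c (n + 1) lam =
      (ε : ℂ[X]) * wronskianDet fun i : Fin (n + 1) => p2 c (lam i + (n - i)) := by
  refine ⟨(Equiv.Perm.sign (Fin.revPerm (n := n + 1)) : ℤˣ), ?_⟩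
  rw [wronskianDet, ← Matrix.det_permute', jacobiTrudi]
  congr 1
  ext1 i j
  simp only [Matrix.of_apply, Matrix.submatrix_apply, iterate_derivative_p2, id, Fin.revPerm_apply,
    Fin.val_rev]
  congr 1
  omega

theorem wronskianDet_comp_perm {n : ℕ} (f : Fin n → ℂ[X]) (σ : Equiv.Perm (Fin n)) :
    wronskianDet (f ∘ σ) = ((Equiv.Perm.sign σ : ℤ) : ℂ[X]) * wronskianDet f := by
  rw [wronskianDet, wronskianDet, ← Matrix.det_permute]
  rfl

theorem exists_perm_comp_eq {n : ℕ} {u v : Fin n → ℕ} (hu : u.Injective) (hv : v.Injective)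
    (h : Set.range u = Set.range v) : ∃ σ : Equiv.Perm (Fin n), u = v ∘ σ := by
  refine ⟨(Equiv.ofInjective u hu).trans
    ((Equiv.setCongr h).trans (Equiv.ofInjective v hv).symm), ?_⟩
  ext1 i
  simp [Equiv.apply_ofInjective_symm hv]

theorem hirotaBil_intCast_mul (c : ℂ) (F G : ℂ[X]) (a b : ℤ) :
    hirotaBil c ((a : ℂ[X]) * F) ((b : ℂ[X]) * G) = (a : ℂ[X]) * b * hirotaBil c F G := by
  simp only [hirotaBil, derivative_mul, derivative_intCast, zero_mul, zero_add]
  ring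

theorem IsMayaPartition.mem_iff {M : Set ℤ} {lam : ℕ → ℕ} {c : ℤ} (h : IsMayaPartition M lam c)
    {n : ℕ} (hn : ∀ i, n + 1 ≤ i → lam i = 0) (z : ℕ) :
    z ∈ Set.range (fun i : Fin (n + 1) => lam i + (n - i)) ↔ (z : ℤ) + (c - (n + 1)) ∈ M := by
  rw [← h.2.2]
  constructor
  · rintro ⟨i, rfl⟩
    refine ⟨i, ?_⟩
    have := i.2
    simp only
    omega
  · rintro ⟨i, hi⟩
    simp only at hi
    have : i < n + 1 := by
      by_contra hc
      have := hn i (by omega)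
      omega
    refine ⟨⟨i, this⟩, ?_⟩
    simp only
    omega

theorem injective_of_antitone {lam : ℕ → ℕ} (h : Antitone lam) (n : ℕ) :
    Function.Injective fun i : Fin (n + 1) => lam i + (n - i) := by
  refine StrictAnti.injective fun i j hij => ?_
  have h1 := h (Fin.le_def.1 hij.le)
  have h2 := Fin.lt_def.1 hij
  have := j.2
  omega

theorem p2_hermite_C (n : ℕ) :
    derivative (derivative (p2 (1 / 2) n)) + X * derivative (p2 (1 / 2) n)
      = C (n : ℂ) * p2 (1 / 2) n := by
  rw [p2_hermite, map_natCast]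

theorem hirotaBil_jacobiTrudi_insert {M : Set ℤ} {a c : ℤ} {lam lam' : ℕ → ℕ} {ℓ ℓ' : ℕ}
    (ha : a ∉ M) (h : IsMayaPartition M lam c) (hℓ : ∀ i, ℓ ≤ i → lam i = 0)
    (h' : IsMayaPartition (insert a M) lam' (c + 1)) (hℓ' : ∀ i, ℓ' ≤ i → lam' i = 0) :
    hirotaBil ((a - c : ℤ) : ℂ) (jacobiTrudi (1 / 2) ℓ lam) (jacobiTrudi (1 / 2) ℓ' lam') = 0 := by
  obtain ⟨n, hn, hn', hna⟩ : ∃ n : ℕ, ℓ ≤ n + 1 ∧ ℓ' ≤ n + 2 ∧ c - (n + 1) ≤ a :=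
    ⟨ℓ + ℓ' + (c - a).toNat, by omega, by omega, by push_cast; omega⟩
  obtain ⟨k, hk⟩ : ∃ k : ℕ, a = k + (c - (n + 1)) := ⟨(a - (c - (n + 1))).toNat, by omega⟩
  rw [← jacobiTrudi_eq_of_le _ hℓ hn, ← jacobiTrudi_eq_of_le _ hℓ' hn']
  obtain ⟨ε, hε⟩ := jacobiTrudi_eq_wronskianDet (1 / 2) n lam
  obtain ⟨ε', hε'⟩ := jacobiTrudi_eq_wronskianDet (1 / 2) (n + 1) lam'
  set u : Fin (n + 1) → ℕ := fun i => lam i + (n - i) with hu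
  have hmem := h.mem_iff (n := n) fun i hi => hℓ i (hn.trans hi)
  have hmem' := h'.mem_iff (n := n + 1) fun i hi => hℓ' i (hn'.trans hi)
  obtain ⟨σ, hσ⟩ := exists_perm_comp_eq (injective_of_antitone h'.1 (n + 1))
    (v := Fin.snoc (α := fun _ => ℕ) u k)
    (by
      rw [Fin.snoc_injective_iff]
      refine ⟨injective_of_antitone h.1 n, fun hc => ha ?_⟩
      rw [hk]
      exact (hmem k).1 hc)
    (by
      rw [Fin.range_snoc]
      ext z
      rw [hmem', Set.mem_insert_iff, Set.mem_insert_iff, hmem z, hk]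
      push_cast
      rw [show (z : ℤ) + (c + 1 - (n + 1 + 1)) = z + (c - (n + 1)) by ring]
      refine or_congr ?_ Iff.rfl
      omega)
  have hcomp : (fun i : Fin (n + 2) => p2 (1 / 2) (lam' i + (n + 1 - i))) =
      Fin.snoc (α := fun _ => ℂ[X]) (fun i => p2 (1 / 2) (u i)) (p2 (1 / 2) k) ∘ σ := by
    ext1 i
    have h1 := congrFun hσ i
    simp only [Function.comp_apply] at h1 ⊢
    rw [h1]
    induction σ i using Fin.lastCases <;> simp
  rw [hε, hε', hcomp, wronskianDet_comp_perm, ← mul_assoc, ← Int.cast_mul, hirotaBil_intCast_mul,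
    show ((a - c : ℤ) : ℂ) = (k : ℂ) - (n + 1) by rw [hk]; push_cast; ring,
    hirotaBil_wronskianDet _ _ (fun i => (u i : ℂ)) k (fun i => p2_hermite_C _) (p2_hermite_C _),
    mul_zero]

theorem mem_mayaSet {m n z : ℤ} : z ∈ mayaSet m n ↔
    (z % 3 = 0 ∧ z / 3 < m) ∨ (z % 3 = 1 ∧ z / 3 < n) ∨ (z % 3 = 2 ∧ z / 3 < 0) := by
  simp only [mayaSet, Set.mem_union, Set.mem_ofPred_eq, or_assoc]
  refine or_congr ?_ (or_congr ?_ ?_)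
  all_goals exact ⟨fun ⟨k, hk, hz⟩ => by omega, fun h => ⟨z / 3, h.2, by omega⟩⟩

theorem IsMayaPartition.charge_eq {m n : ℤ} {lam : ℕ → ℕ} {c : ℤ}
    (h : IsMayaPartition (mayaSet m n) lam c) : c = m + n := by
  obtain ⟨hanti, ⟨N, hN⟩, hrange⟩ := h
  obtain ⟨K, hm, hn, h0, hK⟩ : ∃ K : ℤ, -K ≤ m ∧ -K ≤ n ∧ 0 ≤ K ∧ N ≤ c + 3 * K :=
    ⟨|m| + |n| + |c| + N, by grind, by grind, by grind, by grind⟩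
  obtain ⟨ℓ, hℓ⟩ : ∃ ℓ : ℕ, c + 3 * K = ℓ := ⟨(c + 3 * K).toNat, by omega⟩
  have hcard : ((Finset.range ℓ).image fun i : ℕ => (lam i : ℤ) - ((i : ℤ) + 1) + c).card = ℓ := by
    rw [Finset.card_image_of_injective, Finset.card_range]
    refine StrictAnti.injective fun i j hij => ?_
    have := hanti hij.le
    omega
  have hS : (Finset.range ℓ).image (fun i : ℕ => (lam i : ℤ) - ((i : ℤ) + 1) + c) =
      (Finset.Ico (-K) m).image (fun k => 3 * k) ∪
        ((Finset.Ico (-K) n).image (fun k => 3 * k + 1) ∪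
          (Finset.Ico (-K) 0).image (fun k => 3 * k + 2)) := by
    ext z
    have h1 : z ∈ (Finset.range ℓ).image (fun i : ℕ => (lam i : ℤ) - ((i : ℤ) + 1) + c) ↔
        z ∈ mayaSet m n ∧ -(3 * K) ≤ z := by
      rw [← hrange]
      simp only [Finset.mem_image, Finset.mem_range, Set.mem_range]
      constructor
      · rintro ⟨i, hi, rfl⟩
        exact ⟨⟨i, rfl⟩, by omega⟩
      · rintro ⟨⟨i, rfl⟩, hi⟩
        refine ⟨i, ?_, rfl⟩
        by_contra hc
        have := hN i (by omega)
        omega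
    rw [h1, mem_mayaSet]
    simp only [Finset.mem_union, Finset.mem_image, Finset.mem_Ico]
    constructor
    · rintro ⟨h | h | h, hz⟩
      · exact Or.inl ⟨z / 3, by omega, by omega⟩
      · exact Or.inr (Or.inl ⟨z / 3, by omega, by omega⟩)
      · exact Or.inr (Or.inr ⟨z / 3, by omega, by omega⟩)
    · rintro (⟨k, hk, rfl⟩ | ⟨k, hk, rfl⟩ | ⟨k, hk, rfl⟩) <;> omega
  rw [hS, Finset.card_union_of_disjoint, Finset.card_union_of_disjoint,
    Finset.card_image_of_injective _ fun x y h => by simpa using h,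
    Finset.card_image_of_injective _ fun x y h => by simpa using h,
    Finset.card_image_of_injective _ fun x y h => by simpa using h] at hcard
  · simp only [Int.card_Ico] at hcard
    omega
  · simp only [Finset.disjoint_left, Finset.mem_image, not_exists, not_and]
    rintro _ ⟨k, -, rfl⟩ j -
    omega
  · simp only [Finset.disjoint_left, Finset.mem_union, Finset.mem_image]
    rintro _ ⟨k, -, rfl⟩ (⟨j, -, h⟩ | ⟨j, -, h⟩) <;> omega

theorem IsMayaPartition.add_right {M : Set ℤ} {lam : ℕ → ℕ} {c : ℤ}
    (h : IsMayaPartition M lam c) (d : ℤ) :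
    IsMayaPartition ((fun z => z - d) ⁻¹' M) lam (c + d) := by
  refine ⟨h.1, h.2.1, ?_⟩
  rw [← h.2.2]
  ext z
  simp only [Set.mem_range, Set.mem_preimage]
  refine exists_congr fun i => ?_
  omega

/-- **First family of rational-solution `τ`-functions of Painlevé IV from 3-reduced
Schur polynomials:** for all `m, n ∈ ℤ`, the triple
`(τ₀, τ₁, τ₂) = (s_{m,n}, s_{m+1,n}, s_{m+1,n+1})` satisfies the bilinear form of the
fourth Painlevé equation with parameters
`(α₀, α₁, α₂) = (3m + 1, 3(n − m) + 1, −3n + 1)`. -/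
theorem okamoto_schur_first_family (m n : ℤ) (τ0 τ1 τ2 : Polynomial ℂ)
    (h0 : IsOkamotoS m n τ0) (h1 : IsOkamotoS (m + 1) n τ1)
    (h2 : IsOkamotoS (m + 1) (n + 1) τ2) :
    hirotaBil ((((3 * m + 1 : ℤ) : ℂ) - ((3 * (n - m) + 1 : ℤ) : ℂ)) / 3) τ0 τ1 = 0 ∧
    hirotaBil ((((3 * (n - m) + 1 : ℤ) : ℂ) - ((-3 * n + 1 : ℤ) : ℂ)) / 3) τ1 τ2 = 0 ∧
    hirotaBil ((((-3 * n + 1 : ℤ) : ℂ) - ((3 * m + 1 : ℤ) : ℂ)) / 3) τ2 τ0 = 0 := by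
  obtain ⟨l0, c0, ℓ0, hM0, hl0, rfl⟩ := h0
  obtain ⟨l1, c1, ℓ1, hM1, hl1, rfl⟩ := h1
  obtain ⟨l2, c2, ℓ2, hM2, hl2, rfl⟩ := h2
  obtain rfl := hM0.charge_eq
  obtain rfl := hM1.charge_eq
  obtain rfl := hM2.charge_eq
  refine ⟨?_, ?_, ?_⟩
  · have hM : mayaSet (m + 1) n = insert (3 * m) (mayaSet m n) := by
      ext z
      simp only [Set.mem_insert_iff, mem_mayaSet]
      omega
    rw [hM, show m + 1 + n = m + n + 1 by ring] at hM1
    convert hirotaBil_jacobiTrudi_insert (by rw [mem_mayaSet]; omega) hM0 hl0 hM1 hl1 using 2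
    push_cast
    ring
  · have hM : mayaSet (m + 1) (n + 1) = insert (3 * n + 1) (mayaSet (m + 1) n) := by
      ext z
      simp only [Set.mem_insert_iff, mem_mayaSet]
      omega
    rw [hM, ← add_assoc] at hM2
    convert hirotaBil_jacobiTrudi_insert (by rw [mem_mayaSet]; omega) hM1 hl1 hM2 hl2 using 2
    push_cast
    ring
  · have hM : (fun z => z - 3) ⁻¹' mayaSet m n = insert 2 (mayaSet (m + 1) (n + 1)) := by
      ext z
      simp only [Set.mem_insert_iff, Set.mem_preimage, mem_mayaSet]
      omega
    have hM3 := hM0.add_right 3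
    rw [hM, show m + n + 3 = m + 1 + (n + 1) + 1 by ring] at hM3
    convert hirotaBil_jacobiTrudi_insert (by rw [mem_mayaSet]; omega) hM2 hl2 hM3 hl0 using 2
    push_cast
    ring
end

section
/- For every m, n ∈ ℤ: (i) the partition λ(m,n) has size |λ(m,n)| = m² + n² − mn − m; (ii) the polynomial s_{m,n}(x) has degree m² + n² − mn − m in x with leading coefficient 1/N_{m,n}, where N_{m,n} is the product of the hook lengths of all cells of λ(m,n); and (iii) the Okamoto polynomial Q_{m,n}(x) := N_{m,n}·s_{m,n}(x) is a monic polynomial of degree m² + n² − mn − m with integer coefficients. -/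
/-- The conjugate partition: `conjPart ℓ lam j = λ′_{j+1} = #{i : λᵢ ≥ j+1}`
(0-based `j`). -/
def conjPart (ℓ : ℕ) (lam : ℕ → ℕ) (j : ℕ) : ℕ :=
  ((Finset.range ℓ).filter fun i => j + 1 ≤ lam i).card

/-- The product of the hook lengths `h(i,j) = λᵢ − j + λ′ⱼ − i + 1` over all the cells
of the partition `lam` (of length at most `ℓ`). -/
def hookProd (ℓ : ℕ) (lam : ℕ → ℕ) : ℕ :=
  ∏ i ∈ Finset.range ℓ, ∏ j ∈ Finset.range (lam i),
    (lam i - j + conjPart ℓ lam j - i - 1)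

open Polynomial in
/-- The derivative of a determinant of polynomials, column by column. -/
theorem Polynomial.derivative_det_eq_sum_updateCol {R ι : Type*} [CommRing R] [Fintype ι]
    [DecidableEq ι] (A : Matrix ι ι R[X]) :
    derivative A.det = ∑ k, (A.updateCol k fun i => derivative (A i k)).det := by
  simp only [Matrix.det_apply, derivative_sum]
  rw [Finset.sum_comm]
  refine Finset.sum_congr rfl fun σ _ => ?_
  rw [Units.smul_def, derivative_smul, derivative_prod_finset, Finset.smul_sum]
  refine Finset.sum_congr rfl fun k _ => ?_
  rw [Units.smul_def, ← Finset.mul_prod_erase _ _ (Finset.mem_univ k), mul_comm]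
  congr 2
  · simp
  · refine Finset.prod_congr rfl fun j hj => ?_
    rw [Matrix.updateCol_ne (Finset.ne_of_mem_erase hj)]

namespace OkamotoPolynomial

open Polynomial
open scoped Matrix

section Determinants

variable {ι κ R K : Type*} [Fintype ι] [DecidableEq ι] [Fintype κ] [DecidableEq κ]
  [CommRing R] [Field K]

/-- The determinant of the matrix with entries `P (l i - k j)`. -/
def shiftDet (P : ℤ → R) (l k : ι → ℤ) : R :=
  Matrix.det (Matrix.of fun i j => P (l i - k j))

theorem shiftDet_comp_equiv (P : ℤ → R) (l k : ι → ℤ) (e : κ ≃ ι) :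
    shiftDet P (l ∘ e) (k ∘ e) = shiftDet P l k := by
  rw [shiftDet, shiftDet, ← Matrix.det_submatrix_equiv_self e]
  rfl

/-- The entry in row `u` and column `k` after eliminating the columns `k₀ j` on the rows `l i`. -/
noncomputable def elimEntry (P : ℤ → K) (l k₀ : ι → ℤ) (u k : ℤ) : K :=
  P (u - k) - ∑ i, ((fun j => P (u - k₀ j)) ᵥ* (Matrix.of fun i j => P (l i - k₀ j))⁻¹) i *
    P (l i - k)

theorem shiftDet_sumElim (P : ℤ → K) (l k₀ : ι → ℤ) (a k : κ → ℤ) (h : shiftDet P l k₀ ≠ 0) :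
    shiftDet P (Sum.elim l a) (Sum.elim k₀ k) =
      shiftDet P l k₀ * Matrix.det (Matrix.of fun p q => elimEntry P l k₀ (a p) (k q)) := by
  have hu : IsUnit (Matrix.of fun i j => P (l i - k₀ j)).det := IsUnit.mk0 _ h
  let _ := Matrix.invertibleOfIsUnitDet _ hu
  have hb : (Matrix.of fun i j => P (Sum.elim l a i - Sum.elim k₀ k j)) =
      Matrix.fromBlocks (Matrix.of fun i j => P (l i - k₀ j))
        (Matrix.of fun i q => P (l i - k q)) (Matrix.of fun p j => P (a p - k₀ j))
        (Matrix.of fun p q => P (a p - k q)) := by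
    ext (i | i) (j | j) <;> simp
  rw [shiftDet, hb, Matrix.det_fromBlocks₁₁, shiftDet, Matrix.invOf_eq_nonsing_inv]
  congr 2

theorem elimEntry_eq_zero (P : ℤ → K) (l k₀ : ι → ℤ) (h : shiftDet P l k₀ ≠ 0) (u : ℤ) (j : ι) :
    elimEntry P l k₀ u (k₀ j) = 0 := by
  have hu : IsUnit (Matrix.of fun i j => P (l i - k₀ j)).det := IsUnit.mk0 _ h
  have := congrFun (Matrix.vecMul_vecMul (fun j => P (u - k₀ j))
    (Matrix.of fun i j => P (l i - k₀ j))⁻¹ (Matrix.of fun i j => P (l i - k₀ j))) j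
  rw [Matrix.nonsing_inv_mul _ hu, Matrix.vecMul_one] at this
  rw [elimEntry, sub_eq_zero, ← this]
  rfl

/-- Expansion of the sequence `P (l i - k)` in the columns `k₀ j`. -/
noncomputable def colCoeff (P : ℤ → K) (l k₀ : ι → ℤ) (k : ℤ) : ι → K :=
  (Matrix.of fun i j => P (l i - k₀ j))⁻¹ *ᵥ fun i => P (l i - k)

theorem sum_colCoeff (P : ℤ → K) (l k₀ : ι → ℤ) (h : shiftDet P l k₀ ≠ 0) (k : ℤ) (i : ι) :
    ∑ j, P (l i - k₀ j) * colCoeff P l k₀ k j = P (l i - k) := by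
  have hu : IsUnit (Matrix.of fun i j => P (l i - k₀ j)).det := IsUnit.mk0 _ h
  have := congrFun (Matrix.mulVec_mulVec (fun i => P (l i - k))
    (Matrix.of fun i j => P (l i - k₀ j)) (Matrix.of fun i j => P (l i - k₀ j))⁻¹) i
  rw [Matrix.mul_nonsing_inv _ hu, Matrix.one_mulVec] at this
  rw [← this]
  rfl

theorem det_updateCol_eq_mul_colCoeff (P : ℤ → K) (l k₀ : ι → ℤ) (h : shiftDet P l k₀ ≠ 0)
    (k : ℤ) (j : ι) :
    ((Matrix.of fun i j => P (l i - k₀ j)).updateCol j fun i => P (l i - k)).det =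
      shiftDet P l k₀ * colCoeff P l k₀ k j := by
  have hu : IsUnit (Matrix.of fun i j => P (l i - k₀ j)).det := IsUnit.mk0 _ h
  rw [← Matrix.cramer_apply, ← Matrix.det_smul_inv_mulVec_eq_cramer _ _ hu]
  rfl

theorem colCoeff_self (P : ℤ → K) (l k₀ : ι → ℤ) (h : shiftDet P l k₀ ≠ 0) (j j' : ι) :
    colCoeff P l k₀ (k₀ j') j = if j = j' then 1 else 0 := by
  have hu : IsUnit (Matrix.of fun i j => P (l i - k₀ j)).det := IsUnit.mk0 _ h
  have : colCoeff P l k₀ (k₀ j') j =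
    ((Matrix.of fun i j => P (l i - k₀ j))⁻¹ * (Matrix.of fun i j => P (l i - k₀ j))) j j' := rfl
  rw [this, Matrix.nonsing_inv_mul _ hu, Matrix.one_apply]

/-- The three-term recurrence after elimination of the columns `0, …, n - 1`. -/
theorem elimEntry_recurrence {n : ℕ} (P : ℤ → K) (x : K)
    (hP : ∀ z : ℤ, (z : K) * P z = x * P (z - 1) + P (z - 2)) (l : Fin n → ℤ)
    (h : shiftDet P l (fun j => (j : ℤ)) ≠ 0) :
    ∃ α : K, ∀ u : ℤ, elimEntry P l (fun j => (j : ℤ)) u (n + 2) +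
        x * elimEntry P l (fun j => (j : ℤ)) u (n + 1) =
      (u + α) * elimEntry P l (fun j => (j : ℤ)) u n +
        (∑ j : Fin n, if (j : ℕ) + 1 = n then colCoeff P l (fun j => (j : ℤ)) n j else 0) *
          elimEntry P l (fun j => (j : ℤ)) u (n + 1) := by
  set y := colCoeff P l (fun j => (j : ℤ)) n with hy
  refine ⟨x * (∑ j : Fin n, if (j : ℕ) + 1 = n then y j else 0) +
    (∑ j : Fin n, if (j : ℕ) + 2 = n then y j else 0) - n, fun u => ?_⟩
  set r := ((fun j : Fin n => P (u - (j : ℤ))) ᵥ* (Matrix.of fun i j : Fin n => P (l i - (j : ℤ)))⁻¹)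
    with hr
  set s := elimEntry P l (fun j => (j : ℤ)) u with hs
  have hs1 : ∀ k : ℤ, ∑ i, r i * P (l i - k) = P (u - k) - s k := fun k => by
    rw [hs, elimEntry]; ring
  have hs0 : ∀ j : Fin n, s j = 0 := elimEntry_eq_zero P l _ h u
  have hl : ∀ (w k : ℤ), (w : K) * P (w - k) =
      x * P (w - (k + 1)) + P (w - (k + 2)) + k * P (w - k) := fun w k => by
    have := hP (w - k)
    rw [sub_sub, sub_sub] at this
    rw [← this]; push_cast; ring
  have hL : ∀ k : ℤ, ∑ i, r i * ((l i : K) * P (l i - k)) =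
      u * P (u - k) - x * s (k + 1) - s (k + 2) - k * s k := fun k => by
    have : ∀ i, r i * ((l i : K) * P (l i - k)) = x * (r i * P (l i - (k + 1))) +
        r i * P (l i - (k + 2)) + k * (r i * P (l i - k)) := fun i => by rw [hl]; ring
    simp only [this, Finset.sum_add_distrib, ← Finset.mul_sum, hs1]
    rw [hl u k]; ring
  have hy1 : ∀ i, P (l i - n) = ∑ j : Fin n, P (l i - (j : ℤ)) * y j := fun i =>
    (sum_colCoeff P l _ h n i).symm
  have e1 := hL n
  have e2 : ∑ i, r i * ((l i : K) * P (l i - n)) =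
      ∑ j : Fin n, y j * ∑ i, r i * ((l i : K) * P (l i - (j : ℤ))) := by
    simp only [hy1, Finset.mul_sum]
    rw [Finset.sum_comm]
    refine Finset.sum_congr rfl fun j _ => Finset.sum_congr rfl fun i _ => by ring
  have e3 : P (u - n) - s n = ∑ j : Fin n, y j * P (u - (j : ℤ)) := by
    rw [← hs1]
    simp only [hy1, Finset.mul_sum]
    rw [Finset.sum_comm]
    refine Finset.sum_congr rfl fun j _ => ?_
    have := hs1 j
    rw [hs0, sub_zero] at this
    rw [← this, Finset.mul_sum]
    refine Finset.sum_congr rfl fun i _ => by ring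
  have e4 : ∀ j : Fin n, y j * ∑ i, r i * ((l i : K) * P (l i - (j : ℤ))) =
      u * (y j * P (u - (j : ℤ))) - x * ((if (j : ℕ) + 1 = n then y j else 0) * s n) -
        ((if (j : ℕ) + 2 = n then y j else 0) * s n +
          (if (j : ℕ) + 1 = n then y j else 0) * s (n + 1)) := fun j => by
    rw [hL, hs0]
    have a1 : y j * s ((j : ℤ) + 1) = (if (j : ℕ) + 1 = n then y j else 0) * s n := by
      split_ifs with hj
      · have h1 : (j : ℤ) + 1 = n := by omega
        rw [h1]
      · have := hs0 ⟨j + 1, by omega⟩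
        push_cast at this
        rw [this]; ring
    have a2 : y j * s ((j : ℤ) + 2) = (if (j : ℕ) + 2 = n then y j else 0) * s n +
        (if (j : ℕ) + 1 = n then y j else 0) * s (n + 1) := by
      by_cases h1 : (j : ℕ) + 1 = n
      · have h2 : (j : ℤ) + 2 = n + 1 := by omega
        rw [h2, if_pos h1, if_neg (by omega)]; ring
      · by_cases h2 : (j : ℕ) + 2 = n
        · have h3 : (j : ℤ) + 2 = n := by omega
          rw [h3, if_pos h2, if_neg h1]; ring
        · have := hs0 ⟨j + 2, by omega⟩
          push_cast at this
          rw [this, if_neg h1, if_neg h2]; ring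
    linear_combination -x * a1 - a2
  rw [e1] at e2
  simp only [e4, Finset.sum_sub_distrib, Finset.sum_add_distrib, ← Finset.mul_sum, ← e3,
    ← Finset.sum_mul] at e2
  push_cast at e2
  linear_combination -e2

theorem bilinear_shiftDet {n : ℕ} (P : ℤ → K) (x : K)
    (hP : ∀ z : ℤ, (z : K) * P z = x * P (z - 1) + P (z - 2)) (l : Fin n → ℤ) (u v : ℤ)
    (h : shiftDet P l (fun j => (j : ℤ)) ≠ 0) :
    shiftDet P l (fun j => (j : ℤ)) *
        (shiftDet P (Sum.elim l ![u, v]) (Sum.elim (fun j => (j : ℤ)) ![(n : ℤ), n + 2]) +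
          x * shiftDet P (Sum.elim l ![u, v]) (Sum.elim (fun j => (j : ℤ)) ![(n : ℤ), n + 1])) =
      ((v : K) - u) * shiftDet P (Sum.elim l ![u]) (Sum.elim (fun j => (j : ℤ)) ![(n : ℤ)]) *
          shiftDet P (Sum.elim l ![v]) (Sum.elim (fun j => (j : ℤ)) ![(n : ℤ)]) +
        (∑ k : Fin n, ((Matrix.of fun i j : Fin n => P (l i - (j : ℤ))).updateCol k
            fun i => P (l i - ((k : ℤ) + 1))).det) *
          shiftDet P (Sum.elim l ![u, v]) (Sum.elim (fun j => (j : ℤ)) ![(n : ℤ), n + 1]) := by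
  obtain ⟨α, hα⟩ := elimEntry_recurrence P x hP l h
  have hT : (∑ k : Fin n, ((Matrix.of fun i j : Fin n => P (l i - (j : ℤ))).updateCol k
      fun i => P (l i - ((k : ℤ) + 1))).det) = shiftDet P l (fun j => (j : ℤ)) *
      ∑ j : Fin n, if (j : ℕ) + 1 = n then colCoeff P l (fun j => (j : ℤ)) n j else 0 := by
    rw [Finset.mul_sum]
    refine Finset.sum_congr rfl fun k _ => ?_
    rw [det_updateCol_eq_mul_colCoeff P l _ h]
    congr 1
    split_ifs with hk
    · congr 1; omega
    · have := colCoeff_self P l _ h k ⟨k + 1, by omega⟩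
      push_cast at this
      rw [this, if_neg]
      simp [Fin.ext_iff]
  rw [hT]
  simp only [shiftDet_sumElim P l _ _ _ h, Matrix.det_fin_two, Matrix.det_unique, Matrix.of_apply,
    Matrix.cons_val_zero, Matrix.cons_val_one, Fin.default_eq_zero]
  have hu := hα u
  have hv := hα v
  linear_combination (shiftDet P l (fun j => (j : ℤ))) ^ 2 *
    (elimEntry P l (fun j => (j : ℤ)) u n * hv - elimEntry P l (fun j => (j : ℤ)) v n * hu)

theorem map_shiftDet {S : Type*} [CommRing S] (φ : R →+* S) (P : ℤ → R) (l k : ι → ℤ) :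
    φ (shiftDet P l k) = shiftDet (fun z => φ (P z)) l k := by
  rw [shiftDet, RingHom.map_det]
  rfl

/-- For `P z = p_z`, up to sign the Wronskian of `p_{l 0}, …, p_{l (n - 1)}`. -/
def shiftWronskian (P : ℤ → R) (n : ℕ) (l : ℕ → ℤ) : R :=
  shiftDet P (fun i : Fin n => l i) (fun j => (j : ℤ))

theorem shiftWronskian_add (P : ℤ → R) (n d : ℕ) (l : ℕ → ℤ) :
    shiftWronskian P (n + d) l = shiftDet P (Sum.elim (fun i : Fin n => l i)
      (fun i : Fin d => l (n + i))) (Sum.elim (fun j => (j : ℤ)) (fun j => ((n + j : ℕ) : ℤ))) := by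
  rw [shiftWronskian, ← shiftDet_comp_equiv _ _ _ finSumFinEquiv]
  congr 1 <;> ext (i | i) <;> simp

theorem derivative_shiftWronskian_succ (P : ℤ → R[X]) (hd : ∀ z, derivative (P z) = P (z - 1))
    (n : ℕ) (l : ℕ → ℤ) :
    derivative (shiftWronskian P (n + 1) l) = shiftDet P (fun i : Fin (n + 1) => l i)
      (fun j => if (j : ℕ) = n then (n : ℤ) + 1 else j) := by
  rw [shiftWronskian, shiftDet, derivative_det_eq_sum_updateCol,
    Finset.sum_eq_single (Fin.last n)]
  · rw [shiftDet]
    congr 1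
    ext1 i j
    by_cases hj : j = Fin.last n
    · subst hj
      simp [hd, sub_sub]
    · have : (j : ℕ) ≠ n := fun h => hj (Fin.ext h)
      simp [hj, this]
  · intro k _ hk
    have hk' : (k : ℕ) ≠ n := fun h => hk (Fin.ext h)
    refine Matrix.det_zero_of_column_eq (i := k) (j := ⟨k + 1, by omega⟩)
      (by simp [Fin.ext_iff]) fun i => ?_
    rw [Matrix.updateCol_self, Matrix.updateCol_ne (by simp [Fin.ext_iff])]
    simp [hd, sub_sub]
  · simp

/-- The bilinear (Darboux–Crum) relation between Wronskians of Hermite-type polynomials. -/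
theorem bilinear_shiftWronskian {F : Type*} [Field F] (P : ℤ → F[X])
    (hP : ∀ z : ℤ, (z : F[X]) * P z = X * P (z - 1) + P (z - 2))
    (hd : ∀ z, derivative (P z) = P (z - 1)) (n : ℕ) (l : ℕ → ℤ)
    (h : shiftWronskian P n l ≠ 0) :
    X * shiftWronskian P (n + 2) l * shiftWronskian P n l +
        derivative (shiftWronskian P (n + 2) l) * shiftWronskian P n l -
        shiftWronskian P (n + 2) l * derivative (shiftWronskian P n l) =
      ((l (n + 1) - l n : ℤ) : F[X]) * (shiftWronskian P (n + 1) l *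
        shiftWronskian P (n + 1) (Function.update l n (l (n + 1)))) := by
  set φ := algebraMap F[X] (FractionRing F[X]) with hφ
  have hinj : Function.Injective φ := IsFractionRing.injective _ _
  have hP' : ∀ z : ℤ, (z : FractionRing F[X]) * φ (P z) = φ X * φ (P (z - 1)) + φ (P (z - 2)) :=
    fun z => by rw [← map_mul, ← map_add, ← hP, map_mul, map_intCast]
  have key := bilinear_shiftDet (fun z => φ (P z)) (φ X) hP' (fun i : Fin n => l i) (l n)
    (l (n + 1)) (by
      rw [← map_shiftDet]
      exact (map_ne_zero_iff φ hinj).2 h)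
  have hA : shiftWronskian P (n + 1) l = shiftDet P (Sum.elim (fun i : Fin n => l i) ![l n])
      (Sum.elim (fun j => (j : ℤ)) ![(n : ℤ)]) := by
    rw [shiftWronskian_add]
    congr 2 <;> ext i <;> fin_cases i <;> simp
  have hB : shiftWronskian P (n + 1) (Function.update l n (l (n + 1))) =
      shiftDet P (Sum.elim (fun i : Fin n => l i) ![l (n + 1)])
        (Sum.elim (fun j => (j : ℤ)) ![(n : ℤ)]) := by
    rw [shiftWronskian_add]
    congr 2
    · ext i
      rw [Function.update_of_ne (by omega)]
    · ext i; fin_cases i; simp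
    · ext i; fin_cases i; simp
  have hC : shiftWronskian P (n + 2) l =
      shiftDet P (Sum.elim (fun i : Fin n => l i) ![l n, l (n + 1)])
        (Sum.elim (fun j => (j : ℤ)) ![(n : ℤ), n + 1]) := by
    rw [shiftWronskian_add]
    congr 2 <;> (ext i; fin_cases i <;> simp)
  have hC' : derivative (shiftWronskian P (n + 2) l) =
      shiftDet P (Sum.elim (fun i : Fin n => l i) ![l n, l (n + 1)])
        (Sum.elim (fun j => (j : ℤ)) ![(n : ℤ), n + 2]) := by
    rw [derivative_shiftWronskian_succ P hd (n + 1)]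
    refine (shiftDet_comp_equiv _ _ _ (finSumFinEquiv (m := n) (n := 2))).symm.trans ?_
    congr 1
    · ext (i | i)
      · simp
      · fin_cases i <;> simp
    · ext (i | i)
      · have : (i : ℕ) ≠ n + 1 := by omega
        simp [this]
      · fin_cases i <;> simp <;> ring
  have hT' : derivative (shiftWronskian P n l) =
      ∑ k : Fin n, ((Matrix.of fun i j : Fin n => P (l i - (j : ℤ))).updateCol k
            fun i => P (l i - ((k : ℤ) + 1))).det := by
    rw [shiftWronskian, shiftDet, derivative_det_eq_sum_updateCol]
    simp only [Matrix.of_apply, hd, sub_sub]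
  have hφT' : φ (derivative (shiftWronskian P n l)) =
      ∑ k : Fin n, ((Matrix.of fun i j : Fin n => φ (P (l i - (j : ℤ)))).updateCol k
            fun i => φ (P (l i - ((k : ℤ) + 1)))).det := by
    rw [hT', map_sum]
    refine Finset.sum_congr rfl fun k _ => ?_
    rw [RingHom.map_det]
    congr 1
    ext1 i j
    by_cases hj : j = k
    · subst hj; simp
    · simp [hj]
  rw [← hφT', ← map_shiftDet, ← map_shiftDet, ← map_shiftDet, ← map_shiftDet, ← map_shiftDet,
    ← hA, ← hB, ← hC, ← hC'] at key
  apply hinj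
  rw [← shiftWronskian] at key
  simp only [map_add, map_sub, map_mul, map_intCast, Int.cast_sub]
  linear_combination key

end Determinants

theorem coeff_p2Z_add_two_mul (c : ℂ) (k j : ℕ) :
    (p2Z c (k + 2 * j)).coeff k = c ^ j / ((k.factorial : ℂ) * (j.factorial : ℂ)) := by
  have h1 : ((k : ℤ) + 2 * j).toNat = k + 2 * j := by omega
  rw [p2Z, if_pos (by omega), h1, p2, finsetSum_coeff, Finset.sum_eq_single j]
  · simp
  · intro i hi hij
    rw [Finset.mem_range] at hi
    rw [coeff_C_mul_X_pow, if_neg (by omega)]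
  · intro h
    rw [Finset.mem_range] at h
    omega

theorem coeff_p2Z_eq_zero (c : ℂ) (z : ℤ) (k : ℕ) (h : ∀ j : ℕ, z ≠ k + 2 * j) :
    (p2Z c z).coeff k = 0 := by
  rw [p2Z]
  split_ifs with hz
  · rw [p2, finsetSum_coeff]
    refine Finset.sum_eq_zero fun j hj => ?_
    rw [Finset.mem_range] at hj
    have := h j
    rw [coeff_C_mul_X_pow, if_neg (by omega)]
  · simp

theorem derivative_p2Z (c : ℂ) (z : ℤ) : derivative (p2Z c z) = p2Z c (z - 1) := by
  ext k
  rw [coeff_derivative]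
  by_cases h : ∃ j : ℕ, z = (k + 1 : ℕ) + 2 * j
  · obtain ⟨j, rfl⟩ := h
    have h2 : (((k + 1 : ℕ) : ℤ) + 2 * j - 1) = k + 2 * j := by push_cast; ring
    rw [h2, coeff_p2Z_add_two_mul, coeff_p2Z_add_two_mul, Nat.factorial_succ]
    have : (k : ℂ) + 1 ≠ 0 := by exact_mod_cast k.succ_ne_zero
    have : (k.factorial : ℂ) ≠ 0 := by exact_mod_cast k.factorial_ne_zero
    have : (j.factorial : ℂ) ≠ 0 := by exact_mod_cast j.factorial_ne_zero
    push_cast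
    field_simp
  · push Not at h
    rw [coeff_p2Z_eq_zero _ _ _ h, coeff_p2Z_eq_zero, zero_mul]
    intro j hj
    exact h j (by push_cast; omega)

theorem p2Z_recurrence (z : ℤ) :
    (z : ℂ[X]) * p2Z (1 / 2) z = X * p2Z (1 / 2) (z - 1) + p2Z (1 / 2) (z - 2) := by
  ext k
  rw [← C_eq_intCast, coeff_C_mul, coeff_add]
  by_cases h : ∃ j : ℕ, z = k + 2 * j
  · obtain ⟨j, rfl⟩ := h
    have hX : (X * p2Z (1 / 2) ((k : ℤ) + 2 * j - 1)).coeff k =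
        k * ((1 / 2 : ℂ) ^ j / ((k.factorial : ℂ) * (j.factorial : ℂ))) := by
      rcases k with _ | k
      · simp
      · have h2 : (((k + 1 : ℕ) : ℤ) + 2 * j - 1) = k + 2 * j := by push_cast; ring
        rw [coeff_X_mul, h2, coeff_p2Z_add_two_mul, Nat.factorial_succ]
        have : (k : ℂ) + 1 ≠ 0 := by exact_mod_cast k.succ_ne_zero
        have : (k.factorial : ℂ) ≠ 0 := by exact_mod_cast k.factorial_ne_zero
        have : (j.factorial : ℂ) ≠ 0 := by exact_mod_cast j.factorial_ne_zero
        push_cast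
        field_simp
    have h2 : (p2Z (1 / 2) ((k : ℤ) + 2 * j - 2)).coeff k =
        2 * j * ((1 / 2 : ℂ) ^ j / ((k.factorial : ℂ) * (j.factorial : ℂ))) := by
      rcases j with _ | j
      · rw [coeff_p2Z_eq_zero]
        · simp
        · intro j; omega
      · have h2 : ((k : ℤ) + 2 * (j + 1 : ℕ) - 2) = k + 2 * j := by push_cast; ring
        rw [h2, coeff_p2Z_add_two_mul, Nat.factorial_succ]
        have : (j : ℂ) + 1 ≠ 0 := by exact_mod_cast j.succ_ne_zero
        have : (k.factorial : ℂ) ≠ 0 := by exact_mod_cast k.factorial_ne_zero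
        have : (j.factorial : ℂ) ≠ 0 := by exact_mod_cast j.factorial_ne_zero
        push_cast
        field_simp
        ring
    rw [hX, h2, coeff_p2Z_add_two_mul]
    push_cast
    ring
  · push Not at h
    have hX : (X * p2Z (1 / 2) (z - 1)).coeff k = 0 := by
      rcases k with _ | k
      · simp
      · rw [coeff_X_mul, coeff_p2Z_eq_zero]
        intro j hj
        exact h j (by push_cast; omega)
    rw [hX, coeff_p2Z_eq_zero _ _ _ h, coeff_p2Z_eq_zero]
    · ring
    · intro j hj
      exact h (j + 1) (by push_cast; omega)

/-- The complex polynomials with integer coefficients. -/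
noncomputable def integerPolynomials : Subring ℂ[X] := (mapRingHom (Int.castRingHom ℂ)).range

theorem X_mem_integerPolynomials : (X : ℂ[X]) ∈ integerPolynomials := ⟨X, by simp⟩

theorem derivative_mem_integerPolynomials {p : ℂ[X]} (hp : p ∈ integerPolynomials) :
    derivative p ∈ integerPolynomials := by
  obtain ⟨q, rfl⟩ := hp
  exact ⟨derivative q, by simp [derivative_map]⟩

theorem exists_coeff_eq_intCast {p : ℂ[X]} (hp : p ∈ integerPolynomials) (k : ℕ) :
    ∃ z : ℤ, p.coeff k = z := by
  obtain ⟨q, rfl⟩ := hp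
  exact ⟨q.coeff k, by simp⟩

theorem degree_derivative_mul_sub_lt {F T : ℂ[X]} (hF : F ≠ 0) (hT : T ≠ 0) :
    (derivative F * T - F * derivative T).degree < (X * F * T).degree := by
  have hFT : F * T ≠ 0 := mul_ne_zero hF hT
  have h1 : (X * F * T).degree = (F * T).degree + 1 := by
    rw [mul_assoc, mul_comm, degree_mul_X]
  have h2 : (derivative F * T - F * derivative T).degree ≤ (F * T).degree := by
    refine (degree_sub_le _ _).trans (max_le ?_ ?_)
    · rw [degree_mul, degree_mul]
      gcongr
      exact degree_derivative_le
    · rw [degree_mul, degree_mul]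
      gcongr
      exact degree_derivative_le
  refine h2.trans_lt ?_
  rw [h1, degree_eq_natDegree hFT]
  exact_mod_cast Nat.lt_succ_self _

theorem leadingCoeff_bilinear {F T : ℂ[X]} (hF : F ≠ 0) (hT : T.Monic) :
    (X * F * T + (derivative F * T - F * derivative T)).leadingCoeff = F.leadingCoeff := by
  rw [leadingCoeff_add_of_degree_lt' (degree_derivative_mul_sub_lt hF hT.ne_zero)]
  simp [hT.leadingCoeff]

theorem natDegree_bilinear {F T : ℂ[X]} (hF : F ≠ 0) (hT : T.Monic) :
    (X * F * T + (derivative F * T - F * derivative T)).natDegree =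
      F.natDegree + 1 + T.natDegree := by
  rw [natDegree_add_eq_left_of_degree_lt (degree_derivative_mul_sub_lt hF hT.ne_zero),
    natDegree_mul (mul_ne_zero X_ne_zero hF) hT.ne_zero, natDegree_X_mul hF]

theorem mem_integerPolynomials_of_bilinear {T : ℂ[X]} (hT : T.Monic)
    (hTi : T ∈ integerPolynomials) {F : ℂ[X]}
    (h : X * F * T + (derivative F * T - F * derivative T) ∈ integerPolynomials) :
    F ∈ integerPolynomials := by
  induction hn : F.natDegree using Nat.strong_induction_on generalizing F with
  | _ n ih =>
    by_cases hF : F = 0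
    · rw [hF]; exact zero_mem _
    obtain ⟨z, hz⟩ := exists_coeff_eq_intCast h
      (X * F * T + (derivative F * T - F * derivative T)).natDegree
    rw [coeff_natDegree, leadingCoeff_bilinear hF hT] at hz
    set m : ℂ[X] := (z : ℂ[X]) * X ^ n with hm
    have hmi : m ∈ integerPolynomials :=
      mul_mem (intCast_mem _ z) (pow_mem X_mem_integerPolynomials n)
    have hmF : F = F.eraseLead + m := by
      conv_lhs => rw [← F.eraseLead_add_C_mul_X_pow]
      rw [hz, hn, hm, C_eq_intCast]
    suffices F.eraseLead ∈ integerPolynomials by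
      rw [hmF]; exact add_mem this hmi
    have hop : X * F.eraseLead * T + (derivative F.eraseLead * T - F.eraseLead * derivative T) =
        X * F * T + (derivative F * T - F * derivative T) -
          (X * m * T + (derivative m * T - m * derivative T)) := by
      have : F.eraseLead = F - m := eq_sub_of_add_eq hmF.symm
      rw [this, derivative_sub]; ring
    have hop' : X * F.eraseLead * T + (derivative F.eraseLead * T - F.eraseLead * derivative T) ∈
        integerPolynomials := by
      rw [hop]
      have h1 := derivative_mem_integerPolynomials hmi
      have h2 := derivative_mem_integerPolynomials hTi
      exact sub_mem h (add_mem (mul_mem (mul_mem X_mem_integerPolynomials hmi) hTi)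
        (sub_mem (mul_mem h1 hTi) (mul_mem hmi h2)))
    by_cases hE : F.eraseLead = 0
    · rw [hE]; exact zero_mem _
    · refine ih _ ?_ hop' rfl
      rw [← hn]
      refine lt_of_le_of_ne (eraseLead_natDegree_le_aux) fun heq => hE ?_
      have : F.eraseLead.coeff F.eraseLead.natDegree = 0 := by
        rw [heq, eraseLead_coeff_natDegree]
      rwa [coeff_natDegree, leadingCoeff_eq_zero] at this

theorem exists_monic_p2Z (l : ℕ) : ∃ Q ∈ integerPolynomials, Q.Monic ∧ Q.natDegree = l ∧
    p2Z (1 / 2) l = C ((l.factorial : ℂ)⁻¹) * Q := by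
  induction l using Nat.twoStepInduction with
  | zero => exact ⟨1, one_mem _, monic_one, natDegree_one, by simp [p2Z, p2]⟩
  | one => exact ⟨X, X_mem_integerPolynomials, monic_X, natDegree_X, by simp [p2Z, p2]⟩
  | more l h0 h1 =>
    obtain ⟨Q, hQ, hQm, hQd, hQP⟩ := h0
    obtain ⟨R, hR, hRm, hRd, hRP⟩ := h1
    have hlt : (((l + 1 : ℕ) : ℂ[X]) * Q).degree < (X * R).degree := by
      rw [← C_eq_natCast, degree_C_mul (by exact_mod_cast l.succ_ne_zero), mul_comm, degree_mul_X, degree_eq_natDegree hQm.ne_zero,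
        degree_eq_natDegree hRm.ne_zero, hQd, hRd]
      exact_mod_cast (by omega : l < l + 1 + 1)
    refine ⟨X * R + ((l + 1 : ℕ) : ℂ[X]) * Q, add_mem (mul_mem X_mem_integerPolynomials hR)
      (mul_mem (natCast_mem _ _) hQ), ?_, ?_, ?_⟩
    · exact (monic_X.mul hRm).add_of_left hlt
    · rw [natDegree_add_eq_left_of_degree_lt hlt, natDegree_X_mul hRm.ne_zero, hRd]
    · have h := p2Z_recurrence ((l + 2 : ℕ) : ℤ)
      have e1 : (((l + 2 : ℕ) : ℤ) - 1) = ((l + 1 : ℕ) : ℤ) := by push_cast; ring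
      have e2 : (((l + 2 : ℕ) : ℤ) - 2) = (l : ℤ) := by push_cast; ring
      rw [e1, e2, hQP, hRP] at h
      have h2 : ((l + 2 : ℕ) : ℂ) ≠ 0 := by exact_mod_cast (by omega : l + 2 ≠ 0)
      have h1 : ((l + 1 : ℕ) : ℂ) ≠ 0 := by exact_mod_cast (by omega : l + 1 ≠ 0)
      have hl : (l.factorial : ℂ) ≠ 0 := by exact_mod_cast l.factorial_ne_zero
      have h3 : C ((l + 2 : ℕ) : ℂ) ≠ 0 := C_ne_zero.2 h2
      apply mul_left_cancel₀ h3
      have h4 : (((l + 2 : ℕ) : ℤ) : ℂ[X]) = C ((l + 2 : ℕ) : ℂ) := by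
        rw [Int.cast_natCast, C_eq_natCast]
      have a1 : ((l + 2 : ℕ) : ℂ) * ((l + 2).factorial : ℂ)⁻¹ = ((l + 1).factorial : ℂ)⁻¹ := by
        rw [Nat.factorial_succ (l + 1), Nat.cast_mul, mul_inv, mul_inv_cancel_left₀ h2]
      have a2 : ((l + 1).factorial : ℂ)⁻¹ * ((l + 1 : ℕ) : ℂ) = (l.factorial : ℂ)⁻¹ := by
        rw [Nat.factorial_succ l, Nat.cast_mul]
        field_simp
      rw [h4] at h
      rw [h, ← mul_assoc (C _) (C _), ← C_mul, a1, ← C_eq_natCast, mul_add, ← mul_assoc (C _) (C _),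
        ← C_mul, a2]
      ring

/-- The Vandermonde product of `l 0, …, l (n - 1)`. -/
def vandermondeProd (n : ℕ) (l : ℕ → ℕ) : ℂ :=
  ∏ j ∈ Finset.range n, ∏ i ∈ Finset.range j, ((l j : ℂ) - l i)

theorem vandermondeProd_ne_zero {n : ℕ} {l : ℕ → ℕ} (h : Set.InjOn l (Set.Iio n)) :
    vandermondeProd n l ≠ 0 := by
  refine Finset.prod_ne_zero_iff.2 fun j hj => Finset.prod_ne_zero_iff.2 fun i hi => ?_
  rw [Finset.mem_range] at hi hj
  rw [sub_ne_zero]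
  intro heq
  have := h (Set.mem_Iio.2 hj) (Set.mem_Iio.2 (hi.trans hj)) (by exact_mod_cast heq)
  omega

/-- The normalization constant of the Wronskian of Hermite-type polynomials. -/
noncomputable def wronskianConst (n : ℕ) (l : ℕ → ℕ) : ℂ :=
  vandermondeProd n l / ∏ i ∈ Finset.range n, ((l i).factorial : ℂ)

theorem wronskianConst_ne_zero {n : ℕ} {l : ℕ → ℕ} (h : Set.InjOn l (Set.Iio n)) :
    wronskianConst n l ≠ 0 :=
  div_ne_zero (vandermondeProd_ne_zero h) (Finset.prod_ne_zero_iff.2 fun i _ => by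
    exact_mod_cast (l i).factorial_ne_zero)

theorem wronskianConst_mul (n : ℕ) (l : ℕ → ℕ) :
    wronskianConst (n + 2) l * wronskianConst n l = ((l (n + 1) : ℂ) - l n) *
      (wronskianConst (n + 1) l *
        wronskianConst (n + 1) (Function.update l n (l (n + 1)))) := by
  have h1 : ∀ {j}, j ∈ Finset.range n → Function.update l n (l (n + 1)) j = l j := fun hj => by
    rw [Function.update_of_ne (by rw [Finset.mem_range] at hj; omega)]
  have h2 : vandermondeProd n (Function.update l n (l (n + 1))) = vandermondeProd n l := by
    refine Finset.prod_congr rfl fun j hj => Finset.prod_congr rfl fun i hi => ?_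
    rw [h1 hj, h1]
    rw [Finset.mem_range] at *
    omega
  have h3 : ∏ i ∈ Finset.range n, (((l (n + 1) : ℕ) : ℂ) - Function.update l n (l (n + 1)) i) =
      ∏ i ∈ Finset.range n, ((l (n + 1) : ℂ) - l i) :=
    Finset.prod_congr rfl fun i hi => by rw [h1 hi]
  have h4 : ∏ i ∈ Finset.range n, ((Function.update l n (l (n + 1)) i).factorial : ℂ) =
      ∏ i ∈ Finset.range n, ((l i).factorial : ℂ) :=
    Finset.prod_congr rfl fun i hi => by rw [h1 hi]
  have hf : ∏ i ∈ Finset.range n, ((l i).factorial : ℂ) ≠ 0 :=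
    Finset.prod_ne_zero_iff.2 fun i _ => by exact_mod_cast (l i).factorial_ne_zero
  have hf1 : ((l n).factorial : ℂ) ≠ 0 := by exact_mod_cast (l n).factorial_ne_zero
  have hf2 : ((l (n + 1)).factorial : ℂ) ≠ 0 := by exact_mod_cast (l (n + 1)).factorial_ne_zero
  simp only [wronskianConst, vandermondeProd, Finset.prod_range_succ, Function.update_self] at h2 ⊢
  rw [h2, h3, h4]
  field_simp

theorem exists_monic_shiftWronskian (n : ℕ) (l : ℕ → ℕ) (hl : Set.InjOn l (Set.Iio n)) :
    ∃ Q ∈ integerPolynomials, Q.Monic ∧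
      Q.natDegree + ∑ i ∈ Finset.range n, i = ∑ i ∈ Finset.range n, l i ∧
      shiftWronskian (p2Z (1 / 2)) n (fun i => l i) = C (wronskianConst n l) * Q := by
  induction n using Nat.twoStepInduction generalizing l with
  | zero =>
    exact ⟨1, one_mem _, monic_one, by simp,
      by simp [shiftWronskian, shiftDet, wronskianConst, vandermondeProd]⟩
  | one =>
    obtain ⟨Q, hQ, hQm, hQd, hQP⟩ := exists_monic_p2Z (l 0)
    refine ⟨Q, hQ, hQm, by simpa using hQd, ?_⟩
    simp only [shiftWronskian, shiftDet, Matrix.det_unique, Matrix.of_apply,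
      Fin.default_eq_zero, Fin.val_zero, Nat.cast_zero, sub_zero, hQP]
    simp [wronskianConst, vandermondeProd]
  | more n h0 h1 =>
    obtain ⟨T, hT, hTm, hTd, hTP⟩ := h0 l (hl.mono (Set.Iio_subset_Iio (by omega)))
    obtain ⟨A, hA, hAm, hAd, hAP⟩ := h1 l (hl.mono (Set.Iio_subset_Iio (by omega)))
    obtain ⟨B, hB, hBm, hBd, hBP⟩ := h1 (Function.update l n (l (n + 1))) (by
      intro i hi j hj hij
      simp only [Set.mem_Iio] at hi hj
      have hinj : ∀ a < n + 2, ∀ b < n + 2, l a = l b → a = b := fun a ha b hb => hl ha hb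
      simp only [Function.update_apply] at hij
      split_ifs at hij with h1 h2 h2
      · omega
      · have := hinj _ (by omega) _ (by omega) hij; omega
      · have := hinj _ (by omega) _ (by omega) hij; omega
      · exact hinj _ (by omega) _ (by omega) hij)
    have hc : wronskianConst (n + 2) l ≠ 0 := wronskianConst_ne_zero hl
    have ht : wronskianConst n l ≠ 0 :=
      wronskianConst_ne_zero (hl.mono (Set.Iio_subset_Iio (by omega)))
    have key := bilinear_shiftWronskian (p2Z (1 / 2)) p2Z_recurrence (derivative_p2Z _) n
      (fun i => l i) (by
        rw [hTP]
        exact mul_ne_zero (C_ne_zero.2 ht) hTm.ne_zero)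
    have hup : (Function.update (fun i => (l i : ℤ)) n (l (n + 1) : ℤ)) =
        fun i => ((Function.update l n (l (n + 1)) i : ℕ) : ℤ) := by
      ext i
      by_cases hi : i = n
      · subst hi; simp
      · simp [hi]
    set F := C (wronskianConst (n + 2) l)⁻¹ *
      shiftWronskian (p2Z (1 / 2)) (n + 2) (fun i => l i) with hF
    have hFP : shiftWronskian (p2Z (1 / 2)) (n + 2) (fun i => l i) =
        C (wronskianConst (n + 2) l) * F := by
      rw [hF, ← mul_assoc, ← C_mul, mul_inv_cancel₀ hc, C_1, one_mul]
    rw [hup, hTP, hAP, hBP, hFP] at key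
    have hop : X * F * T + (derivative F * T - F * derivative T) = A * B := by
      apply mul_left_cancel₀ (C_ne_zero.2 (mul_ne_zero hc ht))
      have hk := congrArg C (wronskianConst_mul n l)
      simp only [C_mul, C_sub, C_eq_natCast] at hk
      simp only [derivative_mul, derivative_C, zero_mul, zero_add, Int.cast_sub,
        Int.cast_natCast] at key
      rw [C_mul]
      linear_combination key - A * B * hk
    have hAB : A * B ≠ 0 := (hAm.mul hBm).ne_zero
    have hF0 : F ≠ 0 := by
      intro h
      rw [h] at hop
      apply hAB
      rw [← hop]; simp
    refine ⟨F, mem_integerPolynomials_of_bilinear hTm hT (by rw [hop]; exact mul_mem hA hB), ?_,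
      ?_, hFP⟩
    · rw [Monic, ← leadingCoeff_bilinear hF0 hTm, hop]
      exact hAm.mul hBm
    · have hdeg := natDegree_bilinear hF0 hTm
      rw [hop, hAm.natDegree_mul hBm] at hdeg
      have h3 : ∑ i ∈ Finset.range n, Function.update l n (l (n + 1)) i =
          ∑ i ∈ Finset.range n, l i := Finset.sum_congr rfl fun i hi => by
        rw [Function.update_of_ne (by rw [Finset.mem_range] at hi; omega)]
      simp only [Finset.sum_range_succ, Function.update_self, h3] at *
      omega

theorem lt_conjPart_iff {ℓ : ℕ} {lam : ℕ → ℕ} (hlam : Antitone lam) {k : ℕ} (hk : k < ℓ) (j : ℕ) :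
    k < conjPart ℓ lam j ↔ j + 1 ≤ lam k := by
  constructor
  · intro h
    by_contra hlt
    have hsub : ((Finset.range ℓ).filter fun i => j + 1 ≤ lam i) ⊆ Finset.range k := by
      intro i hi
      rw [Finset.mem_filter] at hi
      rw [Finset.mem_range]
      by_contra hik
      have := hlam (not_lt.1 hik)
      omega
    have := Finset.card_le_card hsub
    rw [Finset.card_range] at this
    exact absurd h (not_lt.2 this)
  · intro h
    have hsub : Finset.range (k + 1) ⊆ (Finset.range ℓ).filter fun i => j + 1 ≤ lam i := by
      intro i hi
      rw [Finset.mem_range] at hi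
      rw [Finset.mem_filter, Finset.mem_range]
      have := hlam (Nat.lt_succ_iff.1 hi)
      omega
    have := Finset.card_le_card hsub
    rwa [Finset.card_range] at this

/-- The strictly increasing sequence of first-column hook lengths. -/
def betaNumber (ℓ : ℕ) (lam : ℕ → ℕ) (a : ℕ) : ℕ := lam (ℓ - 1 - a) + a

theorem betaNumber_lt {ℓ : ℕ} {lam : ℕ → ℕ} (hlam : Antitone lam) {a b : ℕ} (h : b < a) :
    betaNumber ℓ lam b < betaNumber ℓ lam a := by
  have := hlam (by omega : ℓ - 1 - a ≤ ℓ - 1 - b)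
  simp only [betaNumber]
  omega

theorem prod_hook_row {ℓ : ℕ} {lam : ℕ → ℕ} (hlam : Antitone lam) {a : ℕ} (ha : a < ℓ) :
    (∏ j ∈ Finset.range (lam (ℓ - 1 - a)),
        (lam (ℓ - 1 - a) - j + conjPart ℓ lam j - (ℓ - 1 - a) - 1)) *
      ∏ b ∈ Finset.range a, (betaNumber ℓ lam a - betaNumber ℓ lam b) =
    (betaNumber ℓ lam a).factorial := by
  set i := ℓ - 1 - a with hi
  set h : ℕ → ℕ := fun j => lam i - j + conjPart ℓ lam j - i - 1 with hh
  set g : ℕ → ℕ := fun b => betaNumber ℓ lam a - betaNumber ℓ lam b with hg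
  have hi' : i < ℓ := by omega
  have hconj : ∀ j < lam i, i < conjPart ℓ lam j := fun j hj => (lt_conjPart_iff hlam hi' j).2 hj
  have hanti : ∀ j j', j ≤ j' → conjPart ℓ lam j' ≤ conjPart ℓ lam j := by
    intro j j' hj
    refine Finset.card_le_card fun k hk => ?_
    rw [Finset.mem_filter] at hk ⊢
    exact ⟨hk.1, by omega⟩
  have hle : ∀ j, conjPart ℓ lam j ≤ ℓ := fun j =>
    (Finset.card_filter_le _ _).trans (Finset.card_range ℓ).le
  have hhinj : Set.InjOn h (Finset.range (lam i) : Set ℕ) := by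
    intro j hj j' hj' heq
    simp only [Finset.coe_range, Set.mem_Iio] at hj hj'
    have := hconj j hj
    have := hconj j' hj'
    simp only [hh] at heq
    rcases le_total j j' with hjj | hjj
    · have := hanti _ _ hjj
      omega
    · have := hanti _ _ hjj
      omega
  have hginj : Set.InjOn g (Finset.range a : Set ℕ) := by
    intro b hb b' hb' heq
    simp only [Finset.coe_range, Set.mem_Iio] at hb hb'
    have h1 := betaNumber_lt (ℓ := ℓ) hlam hb
    have h2 := betaNumber_lt (ℓ := ℓ) hlam hb'
    simp only [hg] at heq
    rcases lt_trichotomy b b' with hbb | hbb | hbb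
    · have := betaNumber_lt (ℓ := ℓ) hlam hbb
      omega
    · exact hbb
    · have := betaNumber_lt (ℓ := ℓ) hlam hbb
      omega
  have hdisj : Disjoint ((Finset.range (lam i)).image h) ((Finset.range a).image g) := by
    rw [Finset.disjoint_left]
    intro x hx hx'
    obtain ⟨j, hj, rfl⟩ := Finset.mem_image.1 hx
    obtain ⟨b, hb, heq⟩ := Finset.mem_image.1 hx'
    rw [Finset.mem_range] at hj hb
    have h1 := hconj j hj
    have h2 := betaNumber_lt (ℓ := ℓ) hlam hb
    have h3 := lt_conjPart_iff hlam (by omega : ℓ - 1 - b < ℓ) j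
    simp only [hg, hh, betaNumber, ← hi] at heq h2
    by_cases h4 : j + 1 ≤ lam (ℓ - 1 - b)
    · have := h3.2 h4
      omega
    · have := mt h3.1 h4
      omega
  have hunion : (Finset.range (lam i)).image h ∪ (Finset.range a).image g =
      Finset.Ico 1 (betaNumber ℓ lam a + 1) := by
    refine Finset.eq_of_subset_of_card_le (fun x hx => ?_) ?_
    · rw [Finset.mem_union, Finset.mem_image, Finset.mem_image] at hx
      rw [Finset.mem_Ico]
      rcases hx with ⟨j, hj, rfl⟩ | ⟨b, hb, rfl⟩
      · rw [Finset.mem_range] at hj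
        have h1 := hconj j hj
        have h2 := hle j
        simp only [hh, betaNumber, ← hi]
        omega
      · rw [Finset.mem_range] at hb
        have h2 := betaNumber_lt (ℓ := ℓ) hlam hb
        simp only [hg]
        omega
    · rw [Finset.card_union_of_disjoint hdisj, Finset.card_image_of_injOn hhinj,
        Finset.card_image_of_injOn hginj]
      simp [betaNumber, hi]
  rw [← Finset.prod_Ico_id_eq_factorial, ← hunion, Finset.prod_union hdisj,
    Finset.prod_image hhinj, Finset.prod_image hginj]

theorem hookProd_mul_vandermondeProd {ℓ : ℕ} {lam : ℕ → ℕ} (hlam : Antitone lam) :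
    (hookProd ℓ lam : ℂ) * vandermondeProd ℓ (betaNumber ℓ lam) =
      ∏ a ∈ Finset.range ℓ, ((betaNumber ℓ lam a).factorial : ℂ) := by
  rw [hookProd, ← Finset.prod_range_reflect, vandermondeProd, Nat.cast_prod,
    ← Finset.prod_mul_distrib]
  refine Finset.prod_congr rfl fun a ha => ?_
  rw [← prod_hook_row hlam (Finset.mem_range.1 ha), Nat.cast_mul]
  congr 1
  rw [Nat.cast_prod]
  refine Finset.prod_congr rfl fun b hb => ?_
  rw [Nat.cast_sub (betaNumber_lt hlam (Finset.mem_range.1 hb)).le]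

theorem jacobiTrudi_eq_shiftWronskian (c : ℂ) (ℓ : ℕ) (lam : ℕ → ℕ) :
    jacobiTrudi c ℓ lam = shiftWronskian (p2Z c) ℓ (fun a => betaNumber ℓ lam a) := by
  rw [jacobiTrudi, shiftWronskian, shiftDet, ← Matrix.det_submatrix_equiv_self Fin.revPerm]
  congr 1
  ext1 i j
  simp only [Matrix.submatrix_apply, Matrix.of_apply, Fin.revPerm_apply, Fin.val_rev, betaNumber]
  have h1 : ℓ - ((i : ℕ) + 1) = ℓ - 1 - i := by omega
  rw [h1]
  congr 1
  push_cast
  omega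

theorem sum_Ico_id_mul_two (a b : ℤ) (h : a ≤ b) :
    2 * ∑ k ∈ Finset.Ico a b, k = b * (b - 1) - a * (a - 1) := by
  induction b, h using Int.leInduction with
  | base => simp
  | succ b hb ih =>
    rw [← Finset.insert_Ico_right_eq_Ico_add_one hb, Finset.sum_insert (by simp), mul_add, ih]
    ring

theorem sum_range_maya {m n : ℤ} {lam : ℕ → ℕ} {c : ℤ} (hmaya : IsMayaPartition (mayaSet m n) lam c)
    {L : ℕ} (hL : ∀ i, L ≤ i → lam i = 0) {K : ℤ} (hK : (L : ℤ) = 3 * K + c) (g : ℤ → ℤ) :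
    ∑ i ∈ Finset.range L, g ((lam i : ℤ) - ((i : ℤ) + 1) + c) =
      ∑ k ∈ Finset.Ico (-K) m, g (3 * k) + ∑ k ∈ Finset.Ico (-K) n, g (3 * k + 1) +
        ∑ k ∈ Finset.Ico (-K) 0, g (3 * k + 2) := by
  obtain ⟨hanti, -, hrange⟩ := hmaya
  have hinj : Function.Injective fun i : ℕ => (lam i : ℤ) - ((i : ℤ) + 1) + c := by
    intro i j hij
    simp only at hij
    rcases le_total i j with h | h
    · have := hanti h
      omega
    · have := hanti h
      omega
  have himage : (Finset.range L).image (fun i : ℕ => (lam i : ℤ) - ((i : ℤ) + 1) + c) =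
      (Finset.Ico (-K) m).image (fun k => 3 * k) ∪
        (Finset.Ico (-K) n).image (fun k => 3 * k + 1) ∪
        (Finset.Ico (-K) 0).image (fun k => 3 * k + 2) := by
    ext z
    have hz : z ∈ Set.range (fun i : ℕ => (lam i : ℤ) - ((i : ℤ) + 1) + c) ↔
      z ∈ mayaSet m n := by rw [hrange]
    simp only [mayaSet, Set.mem_range, Set.mem_union, Set.mem_ofPred_eq] at hz
    simp only [Finset.mem_image, Finset.mem_union, Finset.mem_Ico, Finset.mem_range]
    constructor
    · rintro ⟨i, hi, rfl⟩
      rcases hz.1 ⟨i, rfl⟩ with (⟨k, hk, h⟩ | ⟨k, hk, h⟩) | ⟨k, hk, h⟩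
      · exact Or.inl (Or.inl ⟨k, ⟨by omega, hk⟩, h.symm⟩)
      · exact Or.inl (Or.inr ⟨k, ⟨by omega, hk⟩, h.symm⟩)
      · exact Or.inr ⟨k, ⟨by omega, hk⟩, h.symm⟩
    · intro h
      have hKz : -(3 * K) ≤ z := by
        rcases h with (⟨k, hk, rfl⟩ | ⟨k, hk, rfl⟩) | ⟨k, hk, rfl⟩ <;> omega
      obtain ⟨i, rfl⟩ := hz.2 (by
        rcases h with (⟨k, hk, h⟩ | ⟨k, hk, h⟩) | ⟨k, hk, h⟩
        · exact Or.inl (Or.inl ⟨k, hk.2, h.symm⟩)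
        · exact Or.inl (Or.inr ⟨k, hk.2, h.symm⟩)
        · exact Or.inr ⟨k, hk.2, h.symm⟩)
      refine ⟨i, ?_, rfl⟩
      by_contra hi
      have := hL i (by omega)
      simp only [this] at hKz
      omega
  rw [← Finset.sum_image (f := g) (g := fun i : ℕ => (lam i : ℤ) - ((i : ℤ) + 1) + c)
    hinj.injOn, himage, Finset.sum_union, Finset.sum_union, Finset.sum_image, Finset.sum_image,
    Finset.sum_image]
  · intro a _ b _ h
    simp only at h
    omega
  · intro a _ b _ h
    simp only at h
    omega
  · intro a _ b _ h
    simp only at h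
    omega
  · rw [Finset.disjoint_left]
    simp only [Finset.mem_image]
    rintro _ ⟨a, _, rfl⟩ ⟨b, _, h⟩
    omega
  · rw [Finset.disjoint_left]
    simp only [Finset.mem_image, Finset.mem_union]
    rintro _ (⟨a, _, rfl⟩ | ⟨a, _, rfl⟩) ⟨b, _, h⟩ <;> omega

theorem sum_maya_partition {m n : ℤ} {lam : ℕ → ℕ} {c : ℤ} {ℓ : ℕ}
    (hmaya : IsMayaPartition (mayaSet m n) lam c) (hℓ : ∀ i, ℓ ≤ i → lam i = 0) :
    ∑ i ∈ Finset.range ℓ, (lam i : ℤ) = m ^ 2 + n ^ 2 - m * n - m := by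
  obtain ⟨K, hKm, hKn, hK0, hKℓ⟩ : ∃ K : ℤ, -K ≤ m ∧ -K ≤ n ∧ -K ≤ 0 ∧ (ℓ : ℤ) ≤ 3 * K + c :=
    ⟨m.natAbs + n.natAbs + c.natAbs + ℓ, by omega, by omega, by omega, by omega⟩
  obtain ⟨L, hLK⟩ : ∃ L : ℕ, (L : ℤ) = 3 * K + c := ⟨(3 * K + c).toNat, by omega⟩
  have hL : ∀ i, L ≤ i → lam i = 0 := fun i hi => hℓ i (by omega)
  have hcard := sum_range_maya hmaya hL hLK fun _ => 1
  have hsum := sum_range_maya hmaya hL hLK fun z => z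
  have e1 := sum_Ico_id_mul_two _ _ hKm
  have e2 := sum_Ico_id_mul_two _ _ hKn
  have e3 := sum_Ico_id_mul_two _ _ hK0
  have e4 : 2 * ∑ i ∈ Finset.range L, ((i : ℤ)) = L * (L - 1) := by
    clear hLK hL hcard hsum
    induction L with
    | zero => simp
    | succ L ih =>
      rw [Finset.sum_range_succ, mul_add, ih]
      push_cast
      ring
  have e6 (a b : ℤ) : ∑ k ∈ Finset.Ico a b, 3 * k = 3 * ∑ k ∈ Finset.Ico a b, k :=
    (Finset.mul_sum ..).symm
  have e5 : ∑ i ∈ Finset.range L, (lam i : ℤ) = ∑ i ∈ Finset.range ℓ, (lam i : ℤ) := by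
    refine (Finset.sum_subset (Finset.range_subset_range.2 (by omega)) fun i _ hi => ?_).symm
    rw [hℓ i (by simpa using hi), Nat.cast_zero]
  have i1 : ((m - -K).toNat : ℤ) = m + K := by omega
  have i2 : ((n - -K).toNat : ℤ) = n + K := by omega
  have i3 : ((0 - -K).toNat : ℤ) = K := by omega
  simp only [Finset.sum_const, Finset.card_range, Int.card_Ico, nsmul_eq_mul, mul_one, i1, i2,
    i3] at hcard
  simp only [Finset.sum_add_distrib, Finset.sum_sub_distrib, e6, Finset.sum_const,
    Finset.card_range, Int.card_Ico, nsmul_eq_mul, mul_one, i2, i3, e5] at hsum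
  have hc : c = m + n := by omega
  subst hc
  rw [hLK] at hsum e4
  linarith

theorem natDegree_leadingCoeff_of_monic {N : ℂ} (hN : N ≠ 0) {Q : ℂ[X]} (hQ : Q.Monic) :
    (C N⁻¹ * Q).natDegree = Q.natDegree ∧ (C N⁻¹ * Q).leadingCoeff = N⁻¹ ∧
      C N * (C N⁻¹ * Q) = Q := by
  refine ⟨natDegree_C_mul (inv_ne_zero hN), by simp [hQ.leadingCoeff], ?_⟩
  rw [← mul_assoc, ← C_mul, mul_inv_cancel₀ hN, C_1, one_mul]

end OkamotoPolynomial

/-- **Degree and normalization of the 3-reduced Schur polynomials / Okamoto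
polynomials:** for all `m, n ∈ ℤ`, the partition `λ(m,n)` has size
`m² + n² − mn − m`; the polynomial `s_{m,n}(x) = S_{λ(m,n)}(x, 1/2)` has degree
`m² + n² − mn − m` with leading coefficient `1/N_{m,n}` (`N_{m,n}` the product of
the hook lengths of `λ(m,n)`); and `Q_{m,n} = N_{m,n}·s_{m,n}` is a monic polynomial
of that degree with integer coefficients. -/
theorem okamoto_polynomial_degree_monic_integral
    (m n : ℤ) (lam : ℕ → ℕ) (c : ℤ) (ℓ : ℕ)
    (hmaya : IsMayaPartition (mayaSet m n) lam c)
    (hℓ : ∀ i, ℓ ≤ i → lam i = 0) :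
    (∑ i ∈ Finset.range ℓ, (lam i : ℤ)) = m ^ 2 + n ^ 2 - m * n - m ∧
    (jacobiTrudi (1 / 2) ℓ lam).natDegree = (m ^ 2 + n ^ 2 - m * n - m).toNat ∧
    (jacobiTrudi (1 / 2) ℓ lam).leadingCoeff = ((hookProd ℓ lam : ℕ) : ℂ)⁻¹ ∧
    (Polynomial.C ((hookProd ℓ lam : ℕ) : ℂ) * jacobiTrudi (1 / 2) ℓ lam).Monic ∧
    (Polynomial.C ((hookProd ℓ lam : ℕ) : ℂ) * jacobiTrudi (1 / 2) ℓ lam).natDegree =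
      (m ^ 2 + n ^ 2 - m * n - m).toNat ∧
    ∀ k : ℕ, ∃ z : ℤ,
      (Polynomial.C ((hookProd ℓ lam : ℕ) : ℂ) *
        jacobiTrudi (1 / 2) ℓ lam).coeff k = (z : ℂ) := by
  have hanti := hmaya.1
  have hsize := OkamotoPolynomial.sum_maya_partition hmaya hℓ
  have hinj : Set.InjOn (OkamotoPolynomial.betaNumber ℓ lam) (Set.Iio ℓ) :=
    (strictMono_nat_of_lt_succ fun a =>
      OkamotoPolynomial.betaNumber_lt hanti a.lt_succ_self).injective.injOn
  obtain ⟨Q, hQi, hQm, hQd, hQ⟩ := OkamotoPolynomial.exists_monic_shiftWronskian ℓ _ hinj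
  have hVN := OkamotoPolynomial.hookProd_mul_vandermondeProd (ℓ := ℓ) hanti
  have hV := OkamotoPolynomial.vandermondeProd_ne_zero hinj
  have hF : ∏ a ∈ Finset.range ℓ, ((OkamotoPolynomial.betaNumber ℓ lam a).factorial : ℂ) ≠ 0 :=
    Finset.prod_ne_zero_iff.2 fun a _ => by exact_mod_cast Nat.factorial_ne_zero _
  have hN : ((hookProd ℓ lam : ℕ) : ℂ) ≠ 0 := fun h => hF (by rw [← hVN, h, zero_mul])
  have hconst : OkamotoPolynomial.wronskianConst ℓ (OkamotoPolynomial.betaNumber ℓ lam) =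
      ((hookProd ℓ lam : ℕ) : ℂ)⁻¹ := by
    rw [OkamotoPolynomial.wronskianConst, ← hVN]
    field_simp
  have hdeg : Q.natDegree = (m ^ 2 + n ^ 2 - m * n - m).toNat := by
    have h : ∑ a ∈ Finset.range ℓ, OkamotoPolynomial.betaNumber ℓ lam a =
        ∑ i ∈ Finset.range ℓ, lam i + ∑ a ∈ Finset.range ℓ, a := by
      simp only [OkamotoPolynomial.betaNumber, Finset.sum_add_distrib]
      rw [Finset.sum_range_reflect lam]
    rw [h] at hQd
    rw [← hsize, ← Nat.cast_sum, Int.toNat_natCast]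
    omega
  obtain ⟨h1, h2, h3⟩ := OkamotoPolynomial.natDegree_leadingCoeff_of_monic hN hQm
  rw [OkamotoPolynomial.jacobiTrudi_eq_shiftWronskian, hQ, hconst, h1, h2, h3]
  exact ⟨hsize, hdeg, rfl, hQm, hdeg, OkamotoPolynomial.exists_coeff_eq_intCast hQi⟩
end
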